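/- Let q be a prime power and define γ(n, q) := |{A ∈ M(n, F_q) : Tr(A²) = 0 and c_A(t) = f₀(t)·(t − λ) for some λ ∈ F_q with f₀ monic having no roots in F_q}| / |{A ∈ M(n, F_q) : Tr(A²) = 0}|. Then γ(∞, q) := lim_{n→∞} γ(n, q) exists and equals q·c(q)^q/(q−1) > e^{−23/9}. Moreover, for every n with n − 1 ≥ 5(q−1)², |γ(∞, q) − γ(n, q)| ≤ (q²/(1 − (q−1)·q^{−n²/2})) · ((q−1)·q^{−n²/2 − 1} + (q/(q−1))·(q^{−(n+1)} + Γ(n, q))), where Γ(n, q) := (1/2)·16^{q−1}·q^{−(n+1)(n+q)/(2(q−1)) − 1} + (n+1)²·binomial(n+q−2, q−2)·(q/(q−1))^n·q^{−n²/(2(q+1)) + (q−1)n/(2(q+1)) + (q−1)/(4(q+1))}. -/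

import Mathlib

open Matrix Polynomial Filter

/-- `γ(n, q)`: the proportion, among self-dual matrices `A ∈ M(n, F_q)` (those with
`Tr(A²) = 0`), of matrices with a unique eigenvalue in `F_q` of algebraic multiplicity `1`
(i.e. `c_A(t) = f₀(t)·(t − λ)` with `λ ∈ F_q` and `f₀` monic with no roots in `F_q`). -/
noncomputable def gammaSD (F : Type*) [Field F] [Fintype F] (n : ℕ) : ℝ :=
  (Nat.card {A : Matrix (Fin n) (Fin n) F //
      (A * A).trace = 0 ∧
      ∃ (lam : F) (f₀ : Polynomial F), f₀.Monic ∧ (∀ t : F, f₀.eval t ≠ 0) ∧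
        A.charpoly = f₀ * (X - C lam)} : ℝ)
    / (Nat.card {A : Matrix (Fin n) (Fin n) F // (A * A).trace = 0} : ℝ)

/-- The error term `Γ(n, q)`. -/
noncomputable def gammaErr (q n : ℕ) : ℝ :=
  (1 / 2) * 16 ^ (q - 1) *
      (q : ℝ) ^ (-(((n : ℝ) + 1) * ((n : ℝ) + (q : ℝ))) / (2 * ((q : ℝ) - 1)) - 1)
    + ((n : ℝ) + 1) ^ 2 * (Nat.choose (n + q - 2) (q - 2) : ℝ) * ((q : ℝ) / ((q : ℝ) - 1)) ^ n *
      (q : ℝ) ^ (-((n : ℝ) ^ 2) / (2 * ((q : ℝ) + 1)) + ((q : ℝ) - 1) * (n : ℝ) / (2 * ((q : ℝ) + 1))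
        + ((q : ℝ) - 1) / (4 * ((q : ℝ) + 1)))

section FittingDecomposition

variable {F : Type*} [Field F]

lemma charpoly_eq_X_pow_of_isNilpotent {ι : Type*} [Fintype ι] [DecidableEq ι]
    {N : Matrix ι ι F} (hN : IsNilpotent N) : N.charpoly = X ^ Fintype.card ι :=
  sub_eq_zero.mp (Matrix.isNilpotent_charpoly_sub_pow_of_isNilpotent hN).eq_zero

lemma eval_charpoly_ne_zero_iff_isUnit {ι : Type*} [Fintype ι] [DecidableEq ι]
    (A : Matrix ι ι F) (s : F) :
    A.charpoly.eval s ≠ 0 ↔ IsUnit (A - Matrix.scalar ι s) := by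
  rw [Matrix.eval_charpoly, ← isUnit_iff_ne_zero, ← Matrix.isUnit_iff_isUnit_det,
    ← IsUnit.neg_iff, neg_sub]

/-- Fitting decomposition: every matrix is, in a suitable basis, the direct sum of a nilpotent
matrix and an invertible one. -/
lemma exists_basis_toMatrix_fitting {ι : Type*} [Fintype ι] [DecidableEq ι] (T : Matrix ι ι F) :
    ∃ (k m : ℕ) (b : Module.Basis (Fin k ⊕ Fin m) F (ι → F)) (N : Matrix (Fin k) (Fin k) F)
      (B : Matrix (Fin m) (Fin m) F), IsNilpotent N ∧ IsUnit B ∧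
        LinearMap.toMatrix b b (Matrix.toLin' T) = Matrix.fromBlocks N 0 0 B := by
  set φ : Module.End F (ι → F) := Matrix.toLin' T with hφ
  obtain ⟨j, hc, hj1⟩ := ((φ.eventually_isCompl_ker_pow_range_pow).and
    (eventually_ge_atTop 1)).exists
  have hK : ∀ x ∈ LinearMap.ker (φ ^ j), φ x ∈ LinearMap.ker (φ ^ j) := by
    intro x hx
    rw [LinearMap.mem_ker] at hx ⊢
    rw [← Module.End.mul_apply, ← pow_succ, pow_succ', Module.End.mul_apply, hx, map_zero]
  have hR : ∀ x ∈ LinearMap.range (φ ^ j), φ x ∈ LinearMap.range (φ ^ j) := by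
    rintro _ ⟨y, rfl⟩
    exact ⟨φ y, by rw [← Module.End.mul_apply, ← Module.End.mul_apply, ← pow_succ, pow_succ']⟩
  let φK := φ.restrict hK
  let φR := φ.restrict hR
  let e := Submodule.prodEquivOfIsCompl _ _ hc
  let bK := Module.finBasis F (LinearMap.ker (φ ^ j))
  let bR := Module.finBasis F (LinearMap.range (φ ^ j))
  refine ⟨_, _, (bK.prod bR).map e, LinearMap.toMatrix bK bK φK, LinearMap.toMatrix bR bR φR,
    ?_, ?_, ?_⟩
  · have hnil : IsNilpotent φK := by
      refine ⟨j, ?_⟩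
      ext x : 1
      rw [Module.End.pow_restrict]
      simp [Subtype.ext_iff]
    exact hnil.map (LinearMap.toMatrixAlgEquiv bK)
  · have hinj : Function.Injective φR := by
      rw [← LinearMap.ker_eq_bot, LinearMap.ker_eq_bot']
      rintro ⟨x, hx⟩ h0
      have h1 : φ x = 0 := by simpa [φR, Subtype.ext_iff] using h0
      have hxj : x ∈ LinearMap.ker (φ ^ j) := by
        rw [LinearMap.mem_ker, ← Nat.sub_add_cancel hj1, pow_succ, Module.End.mul_apply, h1,
          map_zero]
      simpa using hc.disjoint.le_bot ⟨hxj, hx⟩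
    have hu : IsUnit φR := (LinearMap.isUnit_iff_ker_eq_bot φR).mpr (LinearMap.ker_eq_bot.mpr hinj)
    exact hu.map (LinearMap.toMatrixAlgEquiv bR)
  · rw [← LinearMap.toMatrix_prodMap]
    have h2 : ∀ x, e.symm (φ (e x)) = φK.prodMap φR x := fun x => by
      rw [LinearEquiv.symm_apply_eq]
      simp [e, φK, φR]
    ext i j
    simp [LinearMap.toMatrix_apply, h2]

lemma rootMultiplicity_charpoly_fromBlocks {ι κ : Type*} [Fintype ι] [DecidableEq ι] [Fintype κ]
    [DecidableEq κ] {N : Matrix ι ι F} {B : Matrix κ κ F} (hN : IsNilpotent N) (hB : IsUnit B) :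
    (Matrix.fromBlocks N 0 0 B).charpoly.rootMultiplicity 0 = Fintype.card ι := by
  have h0 : ¬ B.charpoly.IsRoot 0 := by
    have := (eval_charpoly_ne_zero_iff_isUnit B 0).mpr (by simpa using hB)
    simpa using this
  rw [Matrix.charpoly_fromBlocks_zero₁₂, charpoly_eq_X_pow_of_isNilpotent hN,
    Polynomial.rootMultiplicity_mul
      (mul_ne_zero (pow_ne_zero _ X_ne_zero) (Matrix.charpoly_monic B).ne_zero),
    Polynomial.rootMultiplicity_eq_zero h0, add_zero]
  have := Polynomial.rootMultiplicity_X_sub_C_pow (0 : F) (Fintype.card ι)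
  rwa [C_0, sub_zero] at this

lemma exists_conj_fromBlocks {k m : ℕ} {T : Matrix (Fin k ⊕ Fin m) (Fin k ⊕ Fin m) F}
    (hT : T.charpoly.rootMultiplicity 0 = k) :
    ∃ (g : (Matrix (Fin k ⊕ Fin m) (Fin k ⊕ Fin m) F)ˣ) (N : Matrix (Fin k) (Fin k) F)
      (B : Matrix (Fin m) (Fin m) F), IsNilpotent N ∧ IsUnit B ∧
        g.val * Matrix.fromBlocks N 0 0 B * g⁻¹.val = T := by
  obtain ⟨k', m', b, N, B, hN, hB, h⟩ := exists_basis_toMatrix_fitting T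
  have hchar : (Matrix.fromBlocks N 0 0 B).charpoly = T.charpoly := by
    rw [← h, LinearMap.charpoly_toMatrix, Matrix.charpoly_toLin']
  have hk : k' = k := by
    rw [← hT, ← hchar, rootMultiplicity_charpoly_fromBlocks hN hB, Fintype.card_fin]
  have hm : k' + m' = k + m := by
    have h1 := Module.finrank_eq_card_basis b
    simp only [Module.finrank_fintype_fun_eq_card, Fintype.card_sum, Fintype.card_fin] at h1
    exact h1.symm
  subst hk
  obtain rfl : m' = m := by omega
  let c := Pi.basisFun F (Fin k' ⊕ Fin m')
  refine ⟨⟨c.toMatrix b, b.toMatrix c, by simp, by simp⟩, N, B, hN, hB, ?_⟩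
  rw [← h]
  simp [c, LinearMap.toMatrix_eq_toMatrix']

/-- A matrix intertwining two direct sums of a nilpotent and an invertible matrix is block
diagonal. -/
lemma intertwining_blocks_eq_zero {ι κ : Type*} [Fintype ι] [DecidableEq ι] [Fintype κ]
    [DecidableEq κ] {N N' : Matrix ι ι F} {B B' : Matrix κ κ F} (hN : IsNilpotent N)
    (hN' : IsNilpotent N') (hB : IsUnit B) (hB' : IsUnit B')
    {h : Matrix (ι ⊕ κ) (ι ⊕ κ) F}
    (hh : h * Matrix.fromBlocks N 0 0 B = Matrix.fromBlocks N' 0 0 B' * h) :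
    h.toBlocks₁₂ = 0 ∧ h.toBlocks₂₁ = 0 ∧ h.toBlocks₁₁ * N = N' * h.toBlocks₁₁ ∧
      h.toBlocks₂₂ * B = B' * h.toBlocks₂₂ := by
  rw [← Matrix.fromBlocks_toBlocks h, Matrix.fromBlocks_multiply, Matrix.fromBlocks_multiply,
    Matrix.fromBlocks_inj] at hh
  simp only [Matrix.mul_zero, Matrix.zero_mul, add_zero, zero_add] at hh
  obtain ⟨h11, h12, h21, h22⟩ := hh
  refine ⟨?_, ?_, h11, h22⟩
  · obtain ⟨j, hj⟩ := hN'
    have hp : ∀ j : ℕ, h.toBlocks₁₂ * B ^ j = N' ^ j * h.toBlocks₁₂ := by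
      intro j
      induction j with
      | zero => simp
      | succ j ih => rw [pow_succ, pow_succ, ← Matrix.mul_assoc, ih, Matrix.mul_assoc, h12,
          Matrix.mul_assoc]
    have h1 := hp j
    rw [hj, Matrix.zero_mul] at h1
    obtain ⟨u, hu⟩ := hB.pow j
    rw [← Matrix.mul_one h.toBlocks₁₂, ← u.mul_inv, hu, ← Matrix.mul_assoc, h1, Matrix.zero_mul]
  · obtain ⟨j, hj⟩ := hN
    have hp : ∀ j : ℕ, h.toBlocks₂₁ * N ^ j = B' ^ j * h.toBlocks₂₁ := by
      intro j
      induction j with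
      | zero => simp
      | succ j ih => rw [pow_succ, pow_succ, ← Matrix.mul_assoc, ih, Matrix.mul_assoc, h21,
          Matrix.mul_assoc]
    have h1 := hp j
    rw [hj, Matrix.mul_zero] at h1
    obtain ⟨u, hu⟩ := hB'.pow j
    rw [← Matrix.one_mul h.toBlocks₂₁, ← u.inv_mul, hu, Matrix.mul_assoc, ← h1, Matrix.mul_zero]

/-- The unit `diag(a, b)`. -/
def unitsFromBlocks {ι κ : Type*} [Fintype ι] [DecidableEq ι] [Fintype κ] [DecidableEq κ]
    (a : (Matrix ι ι F)ˣ) (b : (Matrix κ κ F)ˣ) : (Matrix (ι ⊕ κ) (ι ⊕ κ) F)ˣ where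
  val := Matrix.fromBlocks a.val 0 0 b.val
  inv := Matrix.fromBlocks a⁻¹.val 0 0 b⁻¹.val
  val_inv := by simp [Matrix.fromBlocks_multiply]
  inv_val := by simp [Matrix.fromBlocks_multiply]

lemma exists_unitsFromBlocks {ι κ : Type*} [Fintype ι] [DecidableEq ι] [Fintype κ]
    [DecidableEq κ] (h : (Matrix (ι ⊕ κ) (ι ⊕ κ) F)ˣ) (h12 : h.val.toBlocks₁₂ = 0)
    (h21 : h.val.toBlocks₂₁ = 0) : ∃ a b, unitsFromBlocks a b = h := by
  have hv : h.val = Matrix.fromBlocks h.val.toBlocks₁₁ 0 0 h.val.toBlocks₂₂ := by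
    conv_lhs => rw [← Matrix.fromBlocks_toBlocks h.val, h12, h21]
  have hd : IsUnit h.val.det := (Matrix.isUnit_iff_isUnit_det _).mp h.isUnit
  rw [hv, Matrix.det_fromBlocks_zero₁₂, IsUnit.mul_iff, ← Matrix.isUnit_iff_isUnit_det,
    ← Matrix.isUnit_iff_isUnit_det] at hd
  obtain ⟨⟨a, ha⟩, ⟨b, hb⟩⟩ := hd
  exact ⟨a, b, Units.ext (by rw [hv, unitsFromBlocks]; simp only [ha, hb])⟩

section Counting

variable [Fintype F] {ι κ : Type*} [Fintype ι] [DecidableEq ι] [Fintype κ] [DecidableEq κ]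

open Classical in
/-- The number of ways to write a matrix as a conjugate of a direct sum of a nilpotent and an
invertible matrix. -/
lemma card_fiber_conj_fromBlocks (g₀ : (Matrix (ι ⊕ κ) (ι ⊕ κ) F)ˣ) {N₀ : Matrix ι ι F}
    {B₀ : Matrix κ κ F} (hN₀ : IsNilpotent N₀) (hB₀ : IsUnit B₀) :
    (Finset.univ.filter fun x : (Matrix (ι ⊕ κ) (ι ⊕ κ) F)ˣ × Matrix ι ι F × Matrix κ κ F =>
      (IsNilpotent x.2.1 ∧ IsUnit x.2.2) ∧
        x.1.val * Matrix.fromBlocks x.2.1 0 0 x.2.2 * x.1⁻¹.val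
          = g₀.val * Matrix.fromBlocks N₀ 0 0 B₀ * g₀⁻¹.val).card =
      Fintype.card (Matrix ι ι F)ˣ * Fintype.card (Matrix κ κ F)ˣ := by
  rw [← Fintype.card_prod, ← Finset.card_univ]
  symm
  refine Finset.card_bij (fun y _ => (g₀ * unitsFromBlocks y.1 y.2,
    y.1⁻¹.val * N₀ * y.1.val, y.2⁻¹.val * B₀ * y.2.val)) ?_ ?_ ?_
  · rintro ⟨a, b⟩ -
    simp only [Finset.mem_filter, Finset.mem_univ, true_and]
    refine ⟨⟨?_, ?_⟩, ?_⟩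
    · obtain ⟨j, hj⟩ := hN₀
      refine ⟨j, ?_⟩
      have := Units.conj_pow' a N₀ j
      rw [this, hj]; simp
    · exact (b⁻¹.isUnit.mul hB₀).mul b.isUnit
    · have : (unitsFromBlocks a b).val * Matrix.fromBlocks (a⁻¹.val * N₀ * a.val) 0 0
          (b⁻¹.val * B₀ * b.val) * (unitsFromBlocks a b)⁻¹.val = Matrix.fromBlocks N₀ 0 0 B₀ := by
        rw [Units.mul_inv_eq_iff_eq_mul]
        simp [unitsFromBlocks, Matrix.fromBlocks_multiply, ← Matrix.mul_assoc]
      rw [_root_.mul_inv_rev, Units.val_mul, Units.val_mul, ← this]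
      simp only [Matrix.mul_assoc]
  · rintro ⟨a, b⟩ - ⟨a', b'⟩ - h
    simp only [Prod.mk.injEq, mul_right_inj] at h
    have h1 := congrArg Units.val h.1
    simp only [unitsFromBlocks, Matrix.fromBlocks_inj] at h1
    exact Prod.ext (Units.ext h1.1) (Units.ext h1.2.2.2)
  · rintro ⟨g, N, B⟩ hx
    simp only [Finset.mem_filter, Finset.mem_univ, true_and] at hx
    obtain ⟨⟨hN, hB⟩, hx⟩ := hx
    have hh : (g₀⁻¹ * g).val * Matrix.fromBlocks N 0 0 B =
        Matrix.fromBlocks N₀ 0 0 B₀ * (g₀⁻¹ * g).val := by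
      rw [Units.mul_inv_eq_iff_eq_mul] at hx
      rw [Units.val_mul, Matrix.mul_assoc, hx]
      simp [Matrix.mul_assoc]
    obtain ⟨h12, h21, h11, h22⟩ := intertwining_blocks_eq_zero hN hN₀ hB hB₀ hh
    obtain ⟨a, b, hab⟩ := exists_unitsFromBlocks _ h12 h21
    rw [← hab] at h11 h22
    simp only [unitsFromBlocks, Matrix.toBlocks_fromBlocks₁₁, Matrix.toBlocks_fromBlocks₂₂]
      at h11 h22
    refine ⟨(a, b), Finset.mem_univ _, ?_⟩
    simp only [Prod.mk.injEq]
    refine ⟨by rw [hab, mul_inv_cancel_left], ?_, ?_⟩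
    · rw [Matrix.mul_assoc, ← h11, ← Matrix.mul_assoc, Units.inv_mul, Matrix.one_mul]
    · rw [Matrix.mul_assoc, ← h22, ← Matrix.mul_assoc, Units.inv_mul, Matrix.one_mul]

open Classical in
/-- The sum of a multiplicative class function over the matrices whose nilpotent part has
size `k`. -/
lemma sum_rootMultiplicity_eq {k m : ℕ} (f : Matrix (Fin k ⊕ Fin m) (Fin k ⊕ Fin m) F → ℂ)
    (f₁ : Matrix (Fin k) (Fin k) F → ℂ) (f₂ : Matrix (Fin m) (Fin m) F → ℂ)
    (hf : ∀ (g : (Matrix (Fin k ⊕ Fin m) (Fin k ⊕ Fin m) F)ˣ) N B,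
      f (g.val * Matrix.fromBlocks N 0 0 B * g⁻¹.val) = f₁ N * f₂ B) :
    (∑ T with T.charpoly.rootMultiplicity 0 = k, f T) *
      (Nat.card (Matrix (Fin k) (Fin k) F)ˣ * Nat.card (Matrix (Fin m) (Fin m) F)ˣ) =
    Nat.card (Matrix (Fin k ⊕ Fin m) (Fin k ⊕ Fin m) F)ˣ *
      ((∑ N with IsNilpotent N, f₁ N) * ∑ B with IsUnit B, f₂ B) := by
  simp only [Nat.card_eq_fintype_card]
  set Y := Finset.univ.filter
    fun x : (Matrix (Fin k ⊕ Fin m) (Fin k ⊕ Fin m) F)ˣ × Matrix (Fin k) (Fin k) F ×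
      Matrix (Fin m) (Fin m) F => IsNilpotent x.2.1 ∧ IsUnit x.2.2 with hY
  have hR : ∑ x ∈ Y, f (x.1.val * Matrix.fromBlocks x.2.1 0 0 x.2.2 * x.1⁻¹.val) =
      Fintype.card (Matrix (Fin k ⊕ Fin m) (Fin k ⊕ Fin m) F)ˣ *
      ((∑ N with IsNilpotent N, f₁ N) * ∑ B with IsUnit B, f₂ B) := by
    simp_rw [hf]
    have : Y = Finset.univ ×ˢ ((Finset.univ.filter fun N => IsNilpotent N) ×ˢ
        (Finset.univ.filter fun B => IsUnit B)) := by
      ext x; simp [hY]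
    rw [this, Finset.sum_product]
    simp [Finset.sum_product, Finset.sum_mul_sum]
  rw [← hR, Finset.sum_mul]
  rw [← Finset.sum_fiberwise_of_maps_to (t := Finset.univ.filter
    fun T : Matrix (Fin k ⊕ Fin m) (Fin k ⊕ Fin m) F => T.charpoly.rootMultiplicity 0 = k)
    (s := Y) (g := fun x => x.1.val * Matrix.fromBlocks x.2.1 0 0 x.2.2 * x.1⁻¹.val)]
  · refine Finset.sum_congr rfl fun T hT => ?_
    obtain ⟨g₀, N₀, B₀, hN₀, hB₀, rfl⟩ := exists_conj_fromBlocks (by simpa using hT)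
    rw [Finset.sum_congr rfl (g := fun _ => f (g₀.val * Matrix.fromBlocks N₀ 0 0 B₀ * g₀⁻¹.val))
      (fun x hx => by rw [(Finset.mem_filter.mp hx).2]), Finset.sum_const, nsmul_eq_mul, mul_comm,
      hY, Finset.filter_filter, card_fiber_conj_fromBlocks g₀ hN₀ hB₀, Nat.cast_mul]
  · rintro ⟨g, N, B⟩ hx
    simp only [hY, Finset.mem_filter, Finset.mem_univ, true_and] at hx ⊢
    rw [Matrix.coe_units_inv, Matrix.charpoly_units_conj, rootMultiplicity_charpoly_fromBlocks hx.1 hx.2,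
      Fintype.card_fin]

end Counting

end FittingDecomposition

section Weights

variable {F : Type*} [Field F]

open Classical in
/-- The weight `ψ(Tr(A²))` of a matrix without eigenvalues in `S` (and `0` for the other
matrices). -/
noncomputable def eigenfreeWeight (S : Finset F) (ψ : AddChar F ℂ) {ι : Type*} [Fintype ι]
    [DecidableEq ι] (A : Matrix ι ι F) : ℂ :=
  if ∀ s ∈ S, IsUnit (A - Matrix.scalar ι s) then ψ (A * A).trace else 0

variable (S : Finset F) (ψ : AddChar F ℂ) {ι κ : Type*} [Fintype ι] [DecidableEq ι] [Fintype κ]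
  [DecidableEq κ]

lemma eigenfreeWeight_conj (g : (Matrix ι ι F)ˣ) (A : Matrix ι ι F) :
    eigenfreeWeight S ψ (g.val * A * g⁻¹.val) = eigenfreeWeight S ψ A := by
  have h1 : ∀ s, IsUnit (g.val * A * g⁻¹.val - Matrix.scalar ι s) ↔
      IsUnit (A - Matrix.scalar ι s) := fun s => by
    have : g.val * A * g⁻¹.val - Matrix.scalar ι s =
        g.val * (A - Matrix.scalar ι s) * g⁻¹.val := by
      rw [Matrix.mul_sub, Matrix.sub_mul, ← (Matrix.scalar_commute s (fun _ => mul_comm _ _) _).eq,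
        Matrix.mul_assoc _ g.val, Units.mul_inv, Matrix.mul_one]
    rw [this, Units.isUnit_mul_units, Units.isUnit_units_mul]
  have h2 : (g.val * A * g⁻¹.val * (g.val * A * g⁻¹.val)).trace = (A * A).trace := by
    have : g.val * A * g⁻¹.val * (g.val * A * g⁻¹.val) = g.val * (A * A) * g⁻¹.val := by
      simp [Matrix.mul_assoc]
    rw [this, Matrix.trace_mul_comm, ← Matrix.mul_assoc, Units.inv_mul, Matrix.one_mul]
  unfold eigenfreeWeight
  rw [h2]
  classical
  exact if_congr (forall₂_congr fun s _ => h1 s) rfl rfl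

lemma eigenfreeWeight_reindex (e : ι ≃ κ) (A : Matrix ι ι F) :
    eigenfreeWeight S ψ (Matrix.reindex e e A) = eigenfreeWeight S ψ A := by
  have h1 : ∀ s, IsUnit (Matrix.reindex e e A - Matrix.scalar κ s) ↔
      IsUnit (A - Matrix.scalar ι s) := fun s => by
    rw [← eval_charpoly_ne_zero_iff_isUnit, ← eval_charpoly_ne_zero_iff_isUnit,
      Matrix.charpoly_reindex]
  have h2 : (Matrix.reindex e e A * Matrix.reindex e e A).trace = (A * A).trace := by
    simp only [Matrix.reindex_apply, Matrix.submatrix_mul_equiv]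
    exact Equiv.sum_comp e.symm (fun i => (A * A) i i)
  unfold eigenfreeWeight
  rw [h2]
  classical
  exact if_congr (forall₂_congr fun s _ => h1 s) rfl rfl

lemma eigenfreeWeight_fromBlocks (A : Matrix ι ι F) (B : Matrix κ κ F) :
    eigenfreeWeight S ψ (Matrix.fromBlocks A 0 0 B) =
      eigenfreeWeight S ψ A * eigenfreeWeight S ψ B := by
  have h1 : ∀ s, IsUnit (Matrix.fromBlocks A 0 0 B - Matrix.scalar (ι ⊕ κ) s) ↔
      IsUnit (A - Matrix.scalar ι s) ∧ IsUnit (B - Matrix.scalar κ s) := fun s => by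
    rw [← eval_charpoly_ne_zero_iff_isUnit, ← eval_charpoly_ne_zero_iff_isUnit,
      ← eval_charpoly_ne_zero_iff_isUnit, Matrix.charpoly_fromBlocks_zero₁₂, eval_mul,
      mul_ne_zero_iff]
  have h2 : (Matrix.fromBlocks A 0 0 B * Matrix.fromBlocks A 0 0 B).trace =
      (A * A).trace + (B * B).trace := by
    simp [Matrix.fromBlocks_multiply, Matrix.trace, Fintype.sum_sum_type]
  unfold eigenfreeWeight
  classical
  rw [h2, AddChar.map_add_eq_mul, ite_zero_mul_ite_zero]
  exact if_congr ((forall₂_congr fun s _ => h1 s).trans forall₂_and) rfl rfl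

lemma eigenfreeWeight_add_scalar_of_isNilpotent {t : F} (ht : t ∉ S) {N : Matrix ι ι F}
    (hN : IsNilpotent N) :
    eigenfreeWeight S ψ (N + Matrix.scalar ι t) = ψ (t * t) ^ Fintype.card ι := by
  have h1 : ∀ s ∈ S, IsUnit (N + Matrix.scalar ι t - Matrix.scalar ι s) := fun s hs => by
    rw [add_sub_assoc, ← map_sub]
    have hu : IsUnit (Matrix.scalar ι (t - s)) :=
      (isUnit_iff_ne_zero.mpr (sub_ne_zero.mpr (by rintro rfl; exact ht hs))).map (Matrix.scalar ι)
    exact hN.isUnit_add_right_of_commute hu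
      (Matrix.scalar_commute (t - s) (fun _ => mul_comm _ _) _).symm
  have h2 : ((N + Matrix.scalar ι t) * (N + Matrix.scalar ι t)).trace =
      Fintype.card ι • (t * t) := by
    have hN1 : N.trace = 0 := (Matrix.isNilpotent_trace_of_isNilpotent hN).eq_zero
    have hN2 : (N * N).trace = 0 := (Matrix.isNilpotent_trace_of_isNilpotent
      ((Commute.refl N).isNilpotent_mul_left hN)).eq_zero
    have : (N + Matrix.scalar ι t) * (N + Matrix.scalar ι t) =
        N * N + (2 * t) • N + (t * t) • (1 : Matrix ι ι F) := by
      have hs : Matrix.scalar ι t = t • (1 : Matrix ι ι F) := by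
        rw [Matrix.smul_one_eq_diagonal, Matrix.scalar_apply]
      rw [hs]
      simp only [Matrix.add_mul, Matrix.mul_add, Matrix.mul_smul, Matrix.smul_mul, Matrix.mul_one,
        Matrix.one_mul, smul_add, smul_smul, two_mul, add_smul]
      abel
    rw [this]
    simp [hN1, hN2, Matrix.trace_smul, mul_comm]
  rw [eigenfreeWeight, if_pos h1, h2, AddChar.map_nsmul_eq_pow]

open Classical in
lemma eigenfreeWeight_insert (t : F) (A : Matrix ι ι F) :
    eigenfreeWeight (insert t S) ψ A =
      if IsUnit (A - Matrix.scalar ι t) then eigenfreeWeight S ψ A else 0 := by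
  by_cases h : IsUnit (A - Matrix.scalar ι t)
  · rw [if_pos h]
    unfold eigenfreeWeight
    exact if_congr ((Finset.forall_mem_insert _ _ _).trans (and_iff_right h)) rfl rfl
  · rw [if_neg h, eigenfreeWeight, if_neg fun h' => h (h' t (Finset.mem_insert_self t S))]

variable [Fintype F]

open Classical in
lemma sum_isUnit_eigenfreeWeight_add_scalar (t : F) :
    (∑ B : Matrix ι ι F with IsUnit B, eigenfreeWeight S ψ (B + Matrix.scalar ι t)) =
      ∑ B : Matrix ι ι F, eigenfreeWeight (insert t S) ψ B := by
  rw [← Equiv.sum_comp (Equiv.addRight (Matrix.scalar ι t))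
    (fun B => eigenfreeWeight (insert t S) ψ B), Finset.sum_filter]
  simp only [Equiv.coe_addRight, eigenfreeWeight_insert, add_sub_cancel_right]

variable (F) in
/-- The order of `GL(n, F)`. -/
noncomputable def cardGL (n : ℕ) : ℕ := Nat.card (Matrix (Fin n) (Fin n) F)ˣ

lemma cardGL_pos (n : ℕ) : 0 < cardGL F n := Nat.card_pos

variable (F) in
/-- The number of nilpotent `n × n` matrices. -/
noncomputable def cardNilpotent (n : ℕ) : ℕ :=
  Nat.card {N : Matrix (Fin n) (Fin n) F // IsNilpotent N}

/-- The total weight of the `n × n` matrices. -/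
noncomputable def totalWeight (n : ℕ) : ℂ :=
  ∑ A : Matrix (Fin n) (Fin n) F, eigenfreeWeight S ψ A

open Classical in
lemma sum_eigenfreeWeight_rootMultiplicity {t : F} (ht : t ∉ S) {n k m : ℕ} (h : k + m = n) :
    (∑ T : Matrix (Fin n) (Fin n) F with T.charpoly.rootMultiplicity 0 = k,
        eigenfreeWeight S ψ (T + Matrix.scalar (Fin n) t)) / cardGL F n =
      ψ (t * t) ^ k * (cardNilpotent F k / cardGL F k) *
        (totalWeight (insert t S) ψ m / cardGL F m) := by
  subst h
  have key := sum_rootMultiplicity_eq (k := k) (m := m)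
    (fun T => eigenfreeWeight S ψ (T + Matrix.scalar _ t))
    (fun N => eigenfreeWeight S ψ (N + Matrix.scalar _ t))
    (fun B => eigenfreeWeight S ψ (B + Matrix.scalar _ t)) (fun g N B => by
      rw [← eigenfreeWeight_fromBlocks,
        ← eigenfreeWeight_conj S ψ g (Matrix.fromBlocks (N + _) 0 0 (B + _))]
      congr 1
      have hs : Matrix.fromBlocks (N + Matrix.scalar _ t) 0 0 (B + Matrix.scalar _ t) =
          Matrix.fromBlocks N 0 0 B + Matrix.scalar _ t := by
        have h := Matrix.fromBlocks_diagonal (fun _ : Fin k => t) (fun _ : Fin m => t)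
        rw [Sum.elim_lam_const_lam_const] at h
        rw [Matrix.scalar_apply, Matrix.scalar_apply, Matrix.scalar_apply, ← h,
          Matrix.fromBlocks_add, add_zero, add_zero]
      rw [hs, Matrix.mul_add, Matrix.add_mul,
        ← (Matrix.scalar_commute t (fun _ => mul_comm _ _) _).eq, Matrix.mul_assoc _ g.val,
        Units.mul_inv, Matrix.mul_one])
  rw [sum_isUnit_eigenfreeWeight_add_scalar, Finset.sum_congr rfl (fun N hN =>
    eigenfreeWeight_add_scalar_of_isNilpotent S ψ ht (Finset.mem_filter.mp hN).2),
    Finset.sum_const, Fintype.card_fin, nsmul_eq_mul] at key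
  have hre : (∑ T : Matrix (Fin (k + m)) (Fin (k + m)) F with T.charpoly.rootMultiplicity 0 = k,
        eigenfreeWeight S ψ (T + Matrix.scalar (Fin (k + m)) t)) =
      ∑ T : Matrix (Fin k ⊕ Fin m) (Fin k ⊕ Fin m) F with T.charpoly.rootMultiplicity 0 = k,
        eigenfreeWeight S ψ (T + Matrix.scalar _ t) := by
    rw [Finset.sum_filter, Finset.sum_filter,
      ← Equiv.sum_comp (Matrix.reindex finSumFinEquiv finSumFinEquiv)]
    refine Finset.sum_congr rfl fun T _ => ?_
    rw [Matrix.charpoly_reindex, ← eigenfreeWeight_reindex S ψ finSumFinEquiv]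
    congr 2
    simp [Matrix.submatrix_add]
  have hGL : Nat.card (Matrix (Fin k ⊕ Fin m) (Fin k ⊕ Fin m) F)ˣ = cardGL F (k + m) := by
    exact Nat.card_congr (Units.mapEquiv
      (Matrix.reindexRingEquiv F finSumFinEquiv).toMulEquiv).toEquiv
  rw [hre, div_eq_iff (by exact_mod_cast (cardGL_pos _).ne')]
  have hk : (cardGL F k : ℂ) ≠ 0 := by exact_mod_cast (cardGL_pos _).ne'
  have hm : (cardGL F m : ℂ) ≠ 0 := by exact_mod_cast (cardGL_pos _).ne'
  have hn : (Finset.univ.filter fun N : Matrix (Fin k) (Fin k) F => IsNilpotent N).card =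
      cardNilpotent F k := by
    rw [cardNilpotent, Nat.card_eq_fintype_card, Fintype.card_subtype]
  rw [hn, hGL, show Nat.card (Matrix (Fin k) (Fin k) F)ˣ = cardGL F k from rfl,
    show Nat.card (Matrix (Fin m) (Fin m) F)ˣ = cardGL F m from rfl,
    show ∑ B : Matrix (Fin m) (Fin m) F, eigenfreeWeight (insert t S) ψ B =
      totalWeight (insert t S) ψ m from rfl] at key
  have alg {x a b n c z w : ℂ} (ha : a ≠ 0) (hb : b ≠ 0) (h : x * (a * b) = n * (c * z * w)) :
      x = z * (c / a) * (w / b) * n := by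
    field_simp
    linear_combination h
  exact alg hk hm key

/-- The generating series of the total weights. -/
noncomputable def weightSeries : PowerSeries ℂ :=
  PowerSeries.mk fun n => totalWeight S ψ n / cardGL F n

variable (F) in
/-- The generating series of the numbers of nilpotent matrices. -/
noncomputable def nilpotentSeries : PowerSeries ℂ :=
  PowerSeries.mk fun n => (cardNilpotent F n : ℂ) / cardGL F n

open Classical in
lemma weightSeries_eq_mul {t : F} (ht : t ∉ S) :
    weightSeries S ψ = PowerSeries.rescale (ψ (t * t)) (nilpotentSeries F) *
      weightSeries (insert t S) ψ := by
  ext n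
  rw [PowerSeries.coeff_mul]
  simp only [weightSeries, nilpotentSeries, PowerSeries.coeff_mk, PowerSeries.coeff_rescale]
  have h1 : totalWeight S ψ n = ∑ p ∈ Finset.HasAntidiagonal.antidiagonal n,
      ∑ T : Matrix (Fin n) (Fin n) F with T.charpoly.rootMultiplicity 0 = p.1,
        eigenfreeWeight S ψ (T + Matrix.scalar (Fin n) t) := by
    rw [totalWeight, ← Equiv.sum_comp (Equiv.addRight (Matrix.scalar (Fin n) t)),
      Finset.Nat.sum_antidiagonal_eq_sum_range_succ_mk]
    refine (Finset.sum_fiberwise_of_maps_to (fun T _ => ?_) _).symm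
    rw [Finset.mem_range, Nat.lt_succ_iff]
    rw [← Polynomial.count_roots]
    refine (Multiset.count_le_card _ _).trans ((Polynomial.card_roots' _).trans ?_)
    rw [Matrix.charpoly_natDegree_eq_dim, Fintype.card_fin]
  rw [h1, Finset.sum_div]
  refine Finset.sum_congr rfl fun p hp => ?_
  rw [← sum_eigenfreeWeight_rootMultiplicity S ψ ht (Finset.HasAntidiagonal.mem_antidiagonal.mp hp)]

end Weights

section EulerSeries

variable {K : Type*} [Field K]

/-- The product `(1 - x) (1 - x²) ⋯ (1 - xⁿ)`. -/
def qPoch (x : K) (n : ℕ) : K := ∏ i ∈ Finset.Icc 1 n, (1 - x ^ i)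

@[simp]
lemma qPoch_zero (x : K) : qPoch x 0 = 1 := by simp [qPoch]

lemma qPoch_succ (x : K) (n : ℕ) : qPoch x (n + 1) = qPoch x n * (1 - x ^ (n + 1)) :=
  Finset.prod_Icc_succ_top (by omega) _

lemma qPoch_eq_prod_range (x : K) (n : ℕ) :
    qPoch x n = ∏ i ∈ Finset.range n, (1 - x ^ (n - i)) := by
  rw [← Finset.prod_range_reflect]
  induction n with
  | zero => simp
  | succ n ih =>
    rw [qPoch_succ, Finset.prod_range_succ, ih]
    refine congrArg₂ _ (Finset.prod_congr rfl fun i hi => ?_) (by congr 2; omega)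
    have := Finset.mem_range.mp hi
    congr 2; omega

lemma qPoch_ne_zero {x : K} (hx : ∀ n, x ^ (n + 1) ≠ 1) (n : ℕ) : qPoch x n ≠ 0 := by
  induction n with
  | zero => simp
  | succ n ih => exact qPoch_succ x n ▸ mul_ne_zero ih (sub_ne_zero.mpr (hx n).symm)

/-- Euler's series `∑ uⁿ xⁿ / ((1 - x) ⋯ (1 - xⁿ))`. -/
def eulerSeries (x : K) : PowerSeries K := PowerSeries.mk fun n => x ^ n / qPoch x n

/-- Euler's series `∑ (-1)ⁿ uⁿ x^(n(n+1)/2) / ((1 - x) ⋯ (1 - xⁿ))`. -/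
def eulerInvSeries (x : K) : PowerSeries K :=
  PowerSeries.mk fun n => (-1) ^ n * x ^ ((n + 1).choose 2) / qPoch x n

lemma eulerSeries_mul_one_sub {x : K} (hx : ∀ n, x ^ (n + 1) ≠ 1) :
    eulerSeries x * (1 - PowerSeries.C x * PowerSeries.X) =
      PowerSeries.rescale x (eulerSeries x) := by
  ext n
  rw [mul_sub, mul_one, mul_left_comm, map_sub, PowerSeries.coeff_C_mul,
    PowerSeries.coeff_rescale]
  cases n with
  | zero => simp [eulerSeries]
  | succ n =>
    have h1 := qPoch_ne_zero hx n
    have h2 : 1 - x ^ (n + 1) ≠ 0 := sub_ne_zero.mpr (hx n).symm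
    simp only [PowerSeries.coeff_succ_mul_X, eulerSeries, PowerSeries.coeff_mk, qPoch_succ]
    field_simp
    ring

lemma one_sub_mul_rescale_eulerInvSeries {x : K} (hx : ∀ n, x ^ (n + 1) ≠ 1) :
    (1 - PowerSeries.C x * PowerSeries.X) * PowerSeries.rescale x (eulerInvSeries x) =
      eulerInvSeries x := by
  ext n
  rw [sub_mul, one_mul, mul_assoc, map_sub, PowerSeries.coeff_C_mul]
  cases n with
  | zero => simp [eulerInvSeries]
  | succ n =>
    have h1 := qPoch_ne_zero hx n
    have h2 : 1 - x ^ (n + 1) ≠ 0 := sub_ne_zero.mpr (hx n).symm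
    have h3 : (n + 1 + 1).choose 2 = (n + 1).choose 2 + (n + 1) := by
      rw [Nat.choose_succ_succ' (n + 1) 1, Nat.choose_one_right, add_comm]
    simp only [PowerSeries.coeff_succ_X_mul, eulerInvSeries, PowerSeries.coeff_mk, qPoch_succ,
      PowerSeries.coeff_rescale, h3]
    field_simp
    ring

lemma eulerSeries_mul_eulerInvSeries {x : K} (hx : ∀ n, x ^ (n + 1) ≠ 1) :
    eulerSeries x * eulerInvSeries x = 1 := by
  have h : PowerSeries.rescale x (eulerSeries x * eulerInvSeries x) =
      eulerSeries x * eulerInvSeries x := by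
    conv_rhs => rw [← one_sub_mul_rescale_eulerInvSeries hx, ← mul_assoc,
      eulerSeries_mul_one_sub hx, ← map_mul]
  ext n
  cases n with
  | zero => simp [eulerSeries, eulerInvSeries]
  | succ n =>
    have h1 := congrArg (PowerSeries.coeff (n + 1)) h
    rw [PowerSeries.coeff_rescale] at h1
    have h2 : (x ^ (n + 1) - 1) * PowerSeries.coeff (n + 1) (eulerSeries x * eulerInvSeries x) =
        0 := by linear_combination h1
    rw [(mul_eq_zero.mp h2).resolve_left (sub_ne_zero.mpr (hx n)), PowerSeries.coeff_one,
      if_neg n.succ_ne_zero]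

lemma eulerSeries_mul_mk_one {x : K} (hx : ∀ n, x ^ (n + 1) ≠ 1) :
    eulerSeries x * PowerSeries.mk (fun _ => 1) = PowerSeries.mk fun n => (qPoch x n)⁻¹ := by
  ext n
  rw [PowerSeries.coeff_mul]
  simp only [eulerSeries, PowerSeries.coeff_mk, mul_one]
  rw [Finset.Nat.sum_antidiagonal_eq_sum_range_succ_mk]
  induction n with
  | zero => simp
  | succ n ih =>
    have h1 := qPoch_ne_zero hx n
    have h2 : 1 - x ^ (n + 1) ≠ 0 := sub_ne_zero.mpr (hx n).symm
    rw [Finset.sum_range_succ, ih, qPoch_succ]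
    field_simp
    ring

end EulerSeries

section WeightSeries

variable (F : Type*) [Field F] [Fintype F]

lemma inv_card_pow_succ_ne_one (n : ℕ) : ((Fintype.card F : ℂ)⁻¹) ^ (n + 1) ≠ 1 := by
  rw [inv_pow, ne_eq, inv_eq_one]
  have h : 1 < Fintype.card F := Fintype.one_lt_card
  exact_mod_cast (Nat.one_lt_pow n.succ_ne_zero h).ne'

lemma cardGL_eq (n : ℕ) :
    (cardGL F n : ℂ) = (Fintype.card F : ℂ) ^ (n * n) * qPoch (Fintype.card F : ℂ)⁻¹ n := by
  have h0 : (Fintype.card F : ℂ) ≠ 0 := by exact_mod_cast Fintype.card_ne_zero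
  have h : cardGL F n = ∏ i : Fin n, (Fintype.card F ^ n - Fintype.card F ^ (i : ℕ)) :=
    Matrix.card_GL_field n
  rw [h, qPoch_eq_prod_range, pow_mul, Nat.cast_prod, ← Fin.prod_univ_eq_prod_range,
    ← Fin.prod_const n ((Fintype.card F : ℂ) ^ n), ← Finset.prod_mul_distrib]
  refine Finset.prod_congr rfl fun i _ => ?_
  rw [Nat.cast_sub (Nat.pow_le_pow_right Fintype.card_pos i.2.le), mul_sub, mul_one, inv_pow,
    Nat.cast_pow, Nat.cast_pow, ← pow_sub₀ _ h0 (Nat.sub_le _ _),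
    Nat.sub_sub_self i.2.le]

variable {F} in
lemma card_square_matrix (n : ℕ) :
    Fintype.card (Matrix (Fin n) (Fin n) F) = Fintype.card F ^ (n * n) := by
  rw [Module.card_eq_pow_finrank (K := F), Module.finrank_matrix, Fintype.card_fin,
    Module.finrank_self, mul_one]

lemma weightSeries_empty_one :
    weightSeries (∅ : Finset F) 1 =
      PowerSeries.mk fun n => (qPoch (Fintype.card F : ℂ)⁻¹ n)⁻¹ := by
  have h0 : (Fintype.card F : ℂ) ≠ 0 := by exact_mod_cast Fintype.card_ne_zero
  ext n
  have h : totalWeight (∅ : Finset F) 1 n = (Fintype.card F : ℂ) ^ (n * n) := by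
    simp [totalWeight, eigenfreeWeight, card_square_matrix]
  simp only [weightSeries, PowerSeries.coeff_mk]
  rw [h, cardGL_eq, div_mul_eq_div_div, div_self (pow_ne_zero _ h0), one_div]

lemma weightSeries_singleton_zero_one :
    weightSeries ({0} : Finset F) 1 = PowerSeries.mk fun _ => 1 := by
  ext n
  simp only [weightSeries, PowerSeries.coeff_mk]
  have h : totalWeight ({0} : Finset F) 1 n = cardGL F n := by
    classical
    simp only [totalWeight, eigenfreeWeight, Finset.mem_singleton, forall_eq, map_zero, sub_zero,
      AddChar.one_apply, cardGL]
    rw [Finset.sum_boole, ← Fintype.card_subtype, ← Nat.card_eq_fintype_card]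
    exact congrArg _ (Nat.card_congr (Equiv.ofBijective
      (fun u : (Matrix (Fin n) (Fin n) F)ˣ => (⟨u.val, u.isUnit⟩ : {A // IsUnit A}))
      ⟨fun a b h => Units.ext (congrArg Subtype.val h), fun A => ⟨A.2.unit, rfl⟩⟩).symm)
  rw [h, div_self (by exact_mod_cast (cardGL_pos n).ne')]

lemma nilpotentSeries_eq : nilpotentSeries F = eulerSeries (Fintype.card F : ℂ)⁻¹ := by
  classical
  have h := weightSeries_eq_mul ∅ (1 : AddChar F ℂ) (Finset.notMem_empty 0)
  rw [weightSeries_empty_one, insert_empty_eq, weightSeries_singleton_zero_one,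
    AddChar.one_apply, PowerSeries.rescale_one, RingHom.id_apply,
    ← eulerSeries_mul_mk_one (inv_card_pow_succ_ne_one F)] at h
  exact (mul_right_cancel₀ (fun h0 => by simpa using congrArg (PowerSeries.coeff 0) h0) h).symm

variable {F}

lemma weightSeries_eq_prod (S : Finset F) (ψ : AddChar F ℂ) :
    weightSeries S ψ = weightSeries ∅ ψ *
      ∏ t ∈ S, PowerSeries.rescale (ψ (t * t)) (eulerInvSeries (Fintype.card F : ℂ)⁻¹) := by
  classical
  induction S using Finset.induction_on with
  | empty => simp
  | insert t S ht ih =>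
    have h := weightSeries_eq_mul S ψ ht
    rw [nilpotentSeries_eq] at h
    rw [Finset.prod_insert ht, mul_left_comm, ← ih, h, ← mul_assoc, ← map_mul, mul_comm (eulerInvSeries _),
      eulerSeries_mul_eulerInvSeries (inv_card_pow_succ_ne_one F), map_one, one_mul]

lemma weightSeries_univ_one :
    weightSeries (Finset.univ : Finset F) 1 = (PowerSeries.mk fun _ => 1) *
      eulerInvSeries (Fintype.card F : ℂ)⁻¹ ^ (Fintype.card F - 1) := by
  have hq := inv_card_pow_succ_ne_one F
  obtain ⟨k, hk⟩ := Nat.exists_eq_add_one.mpr (Fintype.card_pos (α := F))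
  rw [weightSeries_eq_prod, weightSeries_empty_one, ← eulerSeries_mul_mk_one hq]
  simp only [AddChar.one_apply, PowerSeries.rescale_one, RingHom.id_apply, Finset.prod_const,
    Finset.card_univ]
  generalize (Fintype.card F : ℂ)⁻¹ = x at *
  rw [hk, Nat.add_sub_cancel, pow_succ]
  linear_combination (PowerSeries.mk (fun _ => 1) * eulerInvSeries x ^ k) *
    eulerSeries_mul_eulerInvSeries hq

end WeightSeries

section GaussSums

variable {F : Type*} [Field F]

lemma exists_addChar_trace_mul_ne_one {ψ : AddChar F ℂ} (hψ : ψ ≠ 1) (h2 : (2 : F) ≠ 0)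
    {ι : Type*} [Fintype ι] {C : Matrix ι ι F} (hC : C ≠ 0) :
    ∃ B : Matrix ι ι F, ψ (2 * (B * C).trace) ≠ 1 := by
  obtain ⟨s, hs⟩ := AddChar.ne_one_iff.mp hψ
  obtain ⟨B, hB⟩ : ∃ B : Matrix ι ι F, (B * C).trace ≠ 0 := by
    by_contra! h
    exact hC (Matrix.ext_iff_trace_mul_left.mpr fun B => by simp [h B])
  refine ⟨(s / (2 * (B * C).trace)) • B, ?_⟩
  rw [Matrix.smul_mul, Matrix.trace_smul, smul_eq_mul, mul_left_comm,
    div_mul_cancel₀ _ (mul_ne_zero h2 hB)]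
  exact hs

variable [Fintype F]

lemma totalWeight_empty (ψ : AddChar F ℂ) (n : ℕ) :
    totalWeight ∅ ψ n = ∑ A : Matrix (Fin n) (Fin n) F, ψ (A * A).trace := by
  simp [totalWeight, eigenfreeWeight]

lemma normSq_totalWeight_of_two_ne_zero {ψ : AddChar F ℂ} (hψ : ψ ≠ 1) (h2 : (2 : F) ≠ 0)
    (n : ℕ) : totalWeight ∅ ψ n * (starRingEnd ℂ) (totalWeight ∅ ψ n) =
      (Fintype.card F : ℂ) ^ (n * n) := by
  classical
  have h (C : Matrix (Fin n) (Fin n) F) :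
      ∑ B : Matrix (Fin n) (Fin n) F,
        ψ ((C + B) * (C + B)).trace * (starRingEnd ℂ) (ψ (B * B).trace) =
      if C = 0 then (Fintype.card F : ℂ) ^ (n * n) else 0 := by
    let χ : AddChar (Matrix (Fin n) (Fin n) F) ℂ := ψ.compAddMonoidHom
      ((AddMonoidHom.mulLeft 2).comp ((Matrix.traceAddMonoidHom (Fin n) F).comp
        (AddMonoidHom.mulRight C)))
    have hχ (B : Matrix (Fin n) (Fin n) F) : ψ ((C + B) * (C + B)).trace *
        (starRingEnd ℂ) (ψ (B * B).trace) = ψ (C * C).trace * χ B := by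
      have h1 : χ B = ψ (2 * (B * C).trace) := rfl
      rw [h1, ← AddChar.map_neg_eq_conj, ← AddChar.map_add_eq_mul, ← AddChar.map_add_eq_mul]
      congr 1
      simp only [Matrix.add_mul, Matrix.mul_add, Matrix.trace_add, Matrix.trace_mul_comm C B]
      ring
    rw [Finset.sum_congr rfl fun B _ => hχ B, ← Finset.mul_sum]
    split_ifs with hC
    · have h1 : ∀ B, χ B = 1 := fun B => by
        change ψ (2 * (B * C).trace) = 1
        simp [hC]
      simp [h1, hC, card_square_matrix]
    · obtain ⟨B, hB⟩ := exists_addChar_trace_mul_ne_one hψ h2 hC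
      rw [AddChar.sum_eq_zero_of_ne_one (AddChar.ne_one_iff.mpr ⟨B, hB⟩), mul_zero]
  rw [totalWeight_empty, map_sum, Finset.sum_mul_sum, Finset.sum_comm]
  rw [Finset.sum_congr rfl fun B _ => (Equiv.sum_comp (Equiv.addRight B) _).symm, Finset.sum_comm]
  simp only [Equiv.coe_addRight, h]
  simp

lemma totalWeight_empty_of_two_eq_zero {ψ : AddChar F ℂ} (hψ : ψ ≠ 1) (h2 : (2 : F) = 0)
    {n : ℕ} (hn : 0 < n) : totalWeight ∅ ψ n = 0 := by
  have : CharP F 2 := CharTwo.of_one_ne_zero_of_two_eq_zero one_ne_zero h2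
  obtain ⟨s, hs⟩ := AddChar.ne_one_iff.mp hψ
  obtain ⟨t, rfl⟩ := (PerfectRing.bijective_frobenius (R := F) (p := 2)).2 s
  let χ : AddChar (Matrix (Fin n) (Fin n) F) ℂ :=
    { toFun := fun A => ψ (A * A).trace
      map_zero_eq_one' := by simp
      map_add_eq_mul' := fun A B => by
        rw [← AddChar.map_add_eq_mul]
        congr 1
        simp only [Matrix.add_mul, Matrix.mul_add, Matrix.trace_add, Matrix.trace_mul_comm B A]
        linear_combination (A * B).trace * h2 }
  rw [totalWeight_empty]
  refine AddChar.sum_eq_zero_of_ne_one (ψ := χ) (AddChar.ne_one_iff.mpr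
    ⟨Matrix.single ⟨0, hn⟩ ⟨0, hn⟩ t, ?_⟩)
  have h (A : Matrix (Fin n) (Fin n) F) : χ A = ψ (A * A).trace := rfl
  rwa [h, Matrix.single_mul_single_same, Matrix.trace_single_eq_same, ← pow_two]

lemma norm_totalWeight_empty_sq_le {ψ : AddChar F ℂ} (hψ : ψ ≠ 1) (n : ℕ) :
    ‖totalWeight ∅ ψ n‖ ^ 2 ≤ (Fintype.card F : ℝ) ^ (n * n) := by
  by_cases h2 : (2 : F) = 0
  · rcases n.eq_zero_or_pos with rfl | hn
    · simp [totalWeight_empty, Matrix.trace, card_square_matrix]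
    · rw [totalWeight_empty_of_two_eq_zero hψ h2 hn]
      simp
  · have h := normSq_totalWeight_of_two_ne_zero hψ h2 n
    rw [Complex.mul_conj, Complex.normSq_eq_norm_sq] at h
    exact (by exact_mod_cast h : ‖totalWeight ∅ ψ n‖ ^ 2 = _).le

end GaussSums

section GaussTerm

/-- The coefficient bound for a product of `k` series with Gaussian decay. -/
noncomputable def gaussTerm (q : ℝ) (k n : ℕ) : ℝ :=
  (n + k).choose k * (q / (q - 1)) ^ n *
    q ^ (-(((n : ℝ) + k / 2) ^ 2 / (2 * (k + 1)) - k / 8))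

variable {q : ℝ}

lemma gaussTerm_nonneg (hq : 2 ≤ q) (k n : ℕ) : 0 ≤ gaussTerm q k n := by
  have : 0 < q - 1 := by linarith
  unfold gaussTerm
  positivity

lemma gaussTerm_zero (n : ℕ) :
    gaussTerm q 0 n = (q / (q - 1)) ^ n * q ^ (-((n : ℝ) ^ 2 / 2)) := by
  simp [gaussTerm]

lemma gauss_exponent_add_le (k : ℕ) (i j : ℝ) :
    (i + j + ((k + 1 : ℕ) : ℝ) / 2) ^ 2 / (2 * (((k + 1 : ℕ) : ℝ) + 1)) - ((k + 1 : ℕ) : ℝ) / 8 ≤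
      ((i + k / 2) ^ 2 / (2 * (k + 1)) - k / 8) + (j ^ 2 + j) / 2 := by
  have hk : (0 : ℝ) < k + 1 := by positivity
  have h : (i + k / 2) ^ 2 / (2 * (k + 1)) - k / 8 + (j ^ 2 + j) / 2 -
      ((i + j + ((k + 1 : ℕ) : ℝ) / 2) ^ 2 / (2 * (((k + 1 : ℕ) : ℝ) + 1)) -
        ((k + 1 : ℕ) : ℝ) / 8) =
      ((i + k / 2) - (k + 1) * (j + 1 / 2)) ^ 2 / (2 * (k + 1) * (k + 2)) := by
    push_cast
    field_simp
    ring
  have : 0 ≤ ((i + k / 2) - (k + 1) * (j + 1 / 2)) ^ 2 / (2 * (k + 1) * ((k : ℝ) + 2)) := by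
    positivity
  linarith

/-- Multiplying by one more series with Gaussian decay. -/
lemma norm_coeff_mul_le_gaussTerm (hq : 2 ≤ q) {k : ℕ} {f P : PowerSeries ℂ}
    (hP : ∀ n, ‖PowerSeries.coeff n P‖ ≤ gaussTerm q k n)
    (hf : ∀ n, ‖PowerSeries.coeff n f‖ ≤
      (q / (q - 1)) ^ n * q ^ (-(((n : ℝ) ^ 2 + n) / 2))) (n : ℕ) :
    ‖PowerSeries.coeff n (P * f)‖ ≤ gaussTerm q (k + 1) n := by
  have hq0 : 0 < q := by linarith
  have hq1 : 0 < q - 1 := by linarith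
  rw [PowerSeries.coeff_mul, Finset.Nat.sum_antidiagonal_eq_sum_range_succ
    (fun i j => PowerSeries.coeff i P * PowerSeries.coeff j f)]
  have hterm : ∀ i ∈ Finset.range (n + 1),
      ‖PowerSeries.coeff i P * PowerSeries.coeff (n - i) f‖ ≤
      ((i + k).choose k : ℝ) * ((q / (q - 1)) ^ n *
        q ^ (-(((n : ℝ) + (k + 1 : ℕ) / 2) ^ 2 / (2 * ((k + 1 : ℕ) + 1)) - (k + 1 : ℕ) / 8))) := by
    intro i hi
    have hin : i ≤ n := Nat.lt_succ_iff.mp (Finset.mem_range.mp hi)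
    obtain ⟨j, rfl⟩ := Nat.exists_eq_add_of_le hin
    rw [Nat.add_sub_cancel_left, norm_mul]
    refine (mul_le_mul (hP i) (hf j) (norm_nonneg _) (gaussTerm_nonneg hq k i)).trans ?_
    have he := gauss_exponent_add_le k i j
    calc gaussTerm q k i * ((q / (q - 1)) ^ j * q ^ (-(((j : ℝ) ^ 2 + j) / 2)))
        = ((i + k).choose k : ℝ) * ((q / (q - 1)) ^ (i + j) *
          (q ^ (-(((i : ℝ) + k / 2) ^ 2 / (2 * (k + 1)) - k / 8)) *
            q ^ (-(((j : ℝ) ^ 2 + j) / 2)))) := by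
          rw [gaussTerm, pow_add]; ring
      _ ≤ _ := by
          rw [← Real.rpow_add hq0]
          gcongr
          · linarith
          · push_cast at he ⊢
            linarith
  refine (norm_sum_le_of_le _ hterm).trans ?_
  rw [← Finset.sum_mul, ← Nat.cast_sum, Nat.sum_range_add_choose, gaussTerm, ← mul_assoc]
  rfl

lemma norm_coeff_mul_prod_le_gaussTerm (hq : 2 ≤ q) {α : Type*} (s : Finset α)
    {f : α → PowerSeries ℂ} {P : PowerSeries ℂ}
    (hP : ∀ n, ‖PowerSeries.coeff n P‖ ≤ gaussTerm q 0 n)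
    (hf : ∀ a n, ‖PowerSeries.coeff n (f a)‖ ≤
      (q / (q - 1)) ^ n * q ^ (-(((n : ℝ) ^ 2 + n) / 2))) (n : ℕ) :
    ‖PowerSeries.coeff n (P * ∏ a ∈ s, f a)‖ ≤ gaussTerm q s.card n := by
  classical
  induction s using Finset.induction_on generalizing n with
  | empty => simpa using hP n
  | insert a s ha ih =>
    rw [Finset.prod_insert ha, mul_comm (f a), ← mul_assoc, Finset.card_insert_of_notMem ha]
    exact norm_coeff_mul_le_gaussTerm hq ih (hf a) n

lemma gaussTerm_succ_le (hq : 2 ≤ q) {k n : ℕ} (hn : 3 * (k + 1) ≤ n) :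
    gaussTerm q k (n + 1) ≤ gaussTerm q k n / 2 := by
  have hq0 : 0 < q := by linarith
  have hq1 : 0 < q - 1 := by linarith
  have hk : (0 : ℝ) < k + 1 := by positivity
  have hn' : 3 * ((k : ℝ) + 1) ≤ n := by exact_mod_cast hn
  have hchoose : ((n + 1 + k).choose k : ℝ) ≤ (n + k).choose k * (4 / 3) := by
    have h := Nat.choose_mul_succ_eq (n + k) k
    rw [show n + k + 1 - k = n + 1 by omega, show n + k + 1 = n + 1 + k by ring] at h
    have h' : ((n + k).choose k : ℝ) * (n + 1 + k) = (n + 1 + k).choose k * (n + 1) := by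
      exact_mod_cast h
    have h0 : (0 : ℝ) ≤ (n + k).choose k := by positivity
    have h1 : (0 : ℝ) < (n : ℝ) + 1 := by positivity
    rw [← mul_le_mul_iff_left₀ h1, ← h']
    nlinarith
  have hb : q / (q - 1) ≤ 2 := by
    rw [div_le_iff₀ hq1]; linarith
  have hexp : q ^ (-(((n + 1 : ℕ) + (k : ℝ) / 2) ^ 2 / (2 * (k + 1)) - k / 8)) ≤
      q ^ (-(((n : ℝ) + k / 2) ^ 2 / (2 * (k + 1)) - k / 8)) * (1 / 8) := by
    have h8 : q ^ (-3 : ℝ) ≤ 1 / 8 := by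
      rw [Real.rpow_neg hq0.le, one_div]
      refine inv_anti₀ (by norm_num) ?_
      have : q ^ (3 : ℝ) = q ^ 3 := by exact_mod_cast Real.rpow_natCast q 3
      rw [this]
      calc (8 : ℝ) = 2 ^ 3 := by norm_num
        _ ≤ q ^ 3 := by gcongr
    refine le_trans ?_ (mul_le_mul_of_nonneg_left h8 (by positivity))
    rw [← Real.rpow_add hq0]
    refine Real.rpow_le_rpow_of_exponent_le (by linarith) ?_
    have : ((n + 1 : ℕ) + (k : ℝ) / 2) ^ 2 / (2 * (k + 1)) - k / 8 -
        (((n : ℝ) + k / 2) ^ 2 / (2 * (k + 1)) - k / 8) - 3 = (2 * n - 5 * (k + 1)) /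
          (2 * (k + 1)) := by
      push_cast
      field_simp
      ring
    have h2 : 0 ≤ (2 * n - 5 * ((k : ℝ) + 1)) / (2 * (k + 1)) :=
      div_nonneg (by linarith) (by positivity)
    linarith
  calc gaussTerm q k (n + 1) ≤ ((n + k).choose k * (4 / 3)) * ((q / (q - 1)) ^ n * 2) *
        (q ^ (-(((n : ℝ) + k / 2) ^ 2 / (2 * (k + 1)) - k / 8)) * (1 / 8)) := by
        rw [gaussTerm, pow_succ]
        gcongr
    _ = gaussTerm q k n / 3 := by rw [gaussTerm]; ring
    _ ≤ gaussTerm q k n / 2 := by linarith [gaussTerm_nonneg hq k n]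

lemma gaussTerm_add_le (hq : 2 ≤ q) {k n : ℕ} (hn : 3 * (k + 1) ≤ n) (i : ℕ) :
    gaussTerm q k (n + i) ≤ gaussTerm q k n * (1 / 2) ^ i := by
  induction i with
  | zero => simp
  | succ i ih =>
    refine (gaussTerm_succ_le hq (hn.trans (Nat.le_add_right n i))).trans ?_
    rw [pow_succ]
    linarith

lemma summable_gaussTerm (hq : 2 ≤ q) (k : ℕ) : Summable (gaussTerm q k) := by
  rw [← summable_nat_add_iff (3 * (k + 1))]
  refine Summable.of_nonneg_of_le (fun i => gaussTerm_nonneg hq k _) (fun i => ?_)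
    (summable_geometric_two.mul_left (gaussTerm q k (3 * (k + 1))))
  rw [add_comm]
  exact gaussTerm_add_le hq le_rfl i

lemma tsum_gaussTerm_add_le (hq : 2 ≤ q) {k n : ℕ} (hn : 3 * (k + 1) ≤ n) :
    ∑' i, gaussTerm q k (n + i) ≤ 2 * gaussTerm q k n := by
  rw [mul_comm, ← tsum_geometric_two, ← tsum_mul_left]
  refine Summable.tsum_le_tsum (gaussTerm_add_le hq hn) ?_
    (summable_geometric_two.mul_left _)
  simpa only [add_comm n] using (summable_nat_add_iff n).mpr (summable_gaussTerm hq k)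

end GaussTerm

section EulerSums

variable {x : ℝ}

lemma qPoch_pos (h0 : 0 < x) (h1 : x < 1) (n : ℕ) : 0 < qPoch x n :=
  Finset.prod_pos fun _ hi => sub_pos.mpr
    (pow_lt_one₀ h0.le h1 (Nat.one_le_iff_ne_zero.mp (Finset.mem_Icc.mp hi).1))

lemma qPoch_le_one (h0 : 0 < x) (h1 : x < 1) (n : ℕ) : qPoch x n ≤ 1 :=
  Finset.prod_le_one (fun _ _ => sub_nonneg.mpr (pow_le_one₀ h0.le h1.le))
    fun i _ => sub_le_self _ (pow_pos h0 i).le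

lemma one_sub_pow_le_qPoch (h0 : 0 < x) (h1 : x < 1) (n : ℕ) : (1 - x) ^ n ≤ qPoch x n := by
  induction n with
  | zero => simp
  | succ n ih =>
    rw [pow_succ, qPoch_succ]
    have : x ^ (n + 1) ≤ x := pow_le_of_le_one h0.le h1.le n.succ_ne_zero
    gcongr
    exact (qPoch_pos h0 h1 n).le

lemma one_sub_sub_sq_add_pow_le_qPoch (h0 : 0 < x) (h1 : x < 1) (n : ℕ) :
    1 - x - x ^ 2 + x ^ (n + 2) ≤ qPoch x (n + 1) := by
  induction n with
  | zero => simp [qPoch]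
  | succ n ih =>
    rw [qPoch_succ]
    have h2 : x ^ (n + 1 + 1) ≤ 1 := pow_le_one₀ h0.le h1.le
    refine le_trans ?_ (mul_le_mul_of_nonneg_right ih (sub_nonneg.mpr h2))
    have h3 : x ^ (n + 2) * x ^ (n + 2) ≤ x ^ (n + 4) := by
      rw [← pow_add]
      exact pow_le_pow_of_le_one h0.le h1.le (by omega)
    have h4 : x ^ (n + 4) = x ^ (n + 2) * x ^ 2 := by ring
    have h5 : x ^ (n + 1 + 2) = x ^ (n + 2) * x := pow_succ _ _
    rw [h5]
    nlinarith

variable {c : ℝ}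

lemma one_sub_sub_sq_le_of_tendsto_qPoch (h0 : 0 < x) (h1 : x < 1)
    (hc : Tendsto (qPoch x) atTop (nhds c)) : 1 - x - x ^ 2 ≤ c := by
  refine ge_of_tendsto hc ((eventually_ge_atTop 1).mono fun n hn => ?_)
  obtain ⟨m, rfl⟩ := Nat.exists_eq_add_of_le' hn
  exact le_trans (by linarith [pow_pos h0 (m + 2)]) (one_sub_sub_sq_add_pow_le_qPoch h0 h1 m)

lemma qPoch_antitone (h0 : 0 < x) (h1 : x < 1) : Antitone (qPoch x) :=
  antitone_nat_of_succ_le fun n => by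
    rw [qPoch_succ]
    exact mul_le_of_le_one_right (qPoch_pos h0 h1 n).le (sub_le_self _ (pow_pos h0 _).le)

lemma qPoch_sub_le_of_tendsto (h0 : 0 < x) (h1 : x < 1)
    (hc : Tendsto (qPoch x) atTop (nhds c)) (n : ℕ) :
    qPoch x n - c ≤ x ^ (n + 1) / (1 - x) := by
  have hx : 0 < 1 - x := sub_pos.mpr h1
  have hmono : Monotone fun n => qPoch x n - x ^ (n + 1) / (1 - x) := by
    refine monotone_nat_of_le_succ fun n => ?_
    have h : qPoch x (n + 1) - x ^ (n + 1 + 1) / (1 - x) - (qPoch x n - x ^ (n + 1) / (1 - x)) =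
        x ^ (n + 1) * (1 - qPoch x n) := by
      rw [qPoch_succ]
      field_simp
      ring
    have := mul_nonneg (pow_pos h0 (n + 1)).le (sub_nonneg.mpr (qPoch_le_one h0 h1 n))
    linarith
  have hlim : Tendsto (fun n => qPoch x n - x ^ (n + 1) / (1 - x)) atTop (nhds c) := by
    have := ((tendsto_pow_atTop_nhds_zero_of_lt_one h0.le h1).comp
      (tendsto_add_atTop_nat 1)).div_const (1 - x)
    simpa using hc.sub this
  linarith [hmono.ge_of_tendsto hlim n]

lemma pow_succ_ne_one_of_lt_one (h0 : 0 < x) (h1 : x < 1) (n : ℕ) : x ^ (n + 1) ≠ 1 :=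
  (pow_lt_one₀ h0.le h1 n.succ_ne_zero).ne

lemma hasSum_coeff_eulerSeries (h0 : 0 < x) (h1 : x < 1) (hc0 : c ≠ 0)
    (hc : Tendsto (qPoch x) atTop (nhds c)) :
    HasSum (fun n => PowerSeries.coeff n (eulerSeries x)) c⁻¹ := by
  rw [hasSum_iff_tendsto_nat_of_nonneg, ← tendsto_add_atTop_iff_nat 1]
  · refine (hc.inv₀ hc0).congr fun n => ?_
    have h := congrArg (PowerSeries.coeff n)
      (eulerSeries_mul_mk_one (pow_succ_ne_one_of_lt_one h0 h1))
    rw [PowerSeries.coeff_mul, Finset.Nat.sum_antidiagonal_eq_sum_range_succ_mk] at h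
    simpa using h.symm
  · intro n
    rw [eulerSeries, PowerSeries.coeff_mk]
    exact div_nonneg (pow_nonneg h0.le n) (qPoch_pos h0 h1 n).le

lemma summable_norm_coeff_mul {f g : PowerSeries ℝ}
    (hf : Summable fun n => ‖PowerSeries.coeff n f‖)
    (hg : Summable fun n => ‖PowerSeries.coeff n g‖) :
    Summable fun n => ‖PowerSeries.coeff n (f * g)‖ := by
  refine (summable_norm_sum_mul_antidiagonal_of_summable_norm hf hg).congr fun n => ?_
  rw [PowerSeries.coeff_mul]

lemma tsum_coeff_mul {f g : PowerSeries ℝ}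
    (hf : Summable fun n => ‖PowerSeries.coeff n f‖)
    (hg : Summable fun n => ‖PowerSeries.coeff n g‖) :
    ∑' n, PowerSeries.coeff n (f * g) =
      (∑' n, PowerSeries.coeff n f) * ∑' n, PowerSeries.coeff n g := by
  simp only [PowerSeries.coeff_mul]
  exact (tsum_mul_tsum_eq_tsum_sum_antidiagonal_of_summable_norm hf hg).symm

lemma tsum_coeff_one : ∑' n, PowerSeries.coeff n (1 : PowerSeries ℝ) = 1 := by
  simp [PowerSeries.coeff_one]

lemma tsum_coeff_pow {f : PowerSeries ℝ} (hf : Summable fun n => ‖PowerSeries.coeff n f‖)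
    (k : ℕ) : (Summable fun n => ‖PowerSeries.coeff n (f ^ k)‖) ∧
      ∑' n, PowerSeries.coeff n (f ^ k) = (∑' n, PowerSeries.coeff n f) ^ k := by
  induction k with
  | zero =>
    refine ⟨summable_of_hasFiniteSupport ((Set.finite_singleton 0).subset fun n hn => ?_), ?_⟩
    · by_contra h
      exact hn (by simpa [PowerSeries.coeff_one] using h)
    · simp
  | succ k ih =>
    simp only [pow_succ]
    exact ⟨summable_norm_coeff_mul ih.1 hf, by rw [tsum_coeff_mul ih.1 hf, ih.2]⟩

lemma ofReal_qPoch (x : ℝ) (n : ℕ) : ((qPoch x n : ℝ) : ℂ) = qPoch (x : ℂ) n := by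
  simp [qPoch]

lemma map_ofReal_eulerInvSeries (x : ℝ) :
    PowerSeries.map Complex.ofRealHom (eulerInvSeries x) = eulerInvSeries (x : ℂ) := by
  ext n
  simp [eulerInvSeries, ofReal_qPoch]

variable {q : ℝ}

lemma inv_qPoch_le (hq : 2 ≤ q) (n : ℕ) : (qPoch q⁻¹ n)⁻¹ ≤ (q / (q - 1)) ^ n := by
  have hq0 : 0 < q := by linarith
  have hq1 : 0 < q - 1 := by linarith
  have h0 : 0 < q⁻¹ := inv_pos.mpr hq0
  have h1 : q⁻¹ < 1 := inv_lt_one_of_one_lt₀ (by linarith)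
  have h : q / (q - 1) = (1 - q⁻¹)⁻¹ := by field_simp
  rw [h, inv_pow]
  exact inv_anti₀ (pow_pos (sub_pos.mpr h1) n) (one_sub_pow_le_qPoch h0 h1 n)

lemma abs_coeff_eulerInvSeries_le (hq : 2 ≤ q) (n : ℕ) :
    |PowerSeries.coeff n (eulerInvSeries q⁻¹)| ≤
      (q / (q - 1)) ^ n * q ^ (-(((n : ℝ) ^ 2 + n) / 2)) := by
  have hq0 : 0 < q := by linarith
  have h0 : 0 < q⁻¹ := inv_pos.mpr hq0
  have h1 : q⁻¹ < 1 := inv_lt_one_of_one_lt₀ (by linarith)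
  have hpow : q⁻¹ ^ (n + 1).choose 2 = q ^ (-(((n : ℝ) ^ 2 + n) / 2)) := by
    rw [Real.rpow_neg hq0.le, inv_pow, ← Real.rpow_natCast, Nat.cast_choose_two]
    push_cast
    ring_nf
  rw [eulerInvSeries, PowerSeries.coeff_mk, abs_div, abs_mul, abs_pow, abs_neg, abs_one, one_pow,
    one_mul, abs_of_pos (pow_pos h0 _), abs_of_pos (qPoch_pos h0 h1 n), hpow, div_eq_mul_inv,
    mul_comm]
  gcongr
  exact inv_qPoch_le hq n

lemma norm_coeff_eulerInvSeries_le (hq : 2 ≤ q) (n : ℕ) :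
    ‖PowerSeries.coeff n (eulerInvSeries (q : ℂ)⁻¹)‖ ≤
      (q / (q - 1)) ^ n * q ^ (-(((n : ℝ) ^ 2 + n) / 2)) := by
  rw [← Complex.ofReal_inv, ← map_ofReal_eulerInvSeries, PowerSeries.coeff_map,
    Complex.ofRealHom_eq_coe, Complex.norm_real]
  exact abs_coeff_eulerInvSeries_le hq n

lemma norm_coeff_eulerInvSeries_le_gaussTerm (hq : 2 ≤ q) (n : ℕ) :
    ‖PowerSeries.coeff n (eulerInvSeries (q : ℂ)⁻¹)‖ ≤ gaussTerm q 0 n := by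
  have hq1 : 0 < q - 1 := by linarith
  have hq0 : 0 < q := by linarith
  refine (norm_coeff_eulerInvSeries_le hq n).trans ?_
  rw [gaussTerm_zero]
  gcongr
  · linarith
  · linarith [(n.cast_nonneg : (0 : ℝ) ≤ n)]

lemma abs_coeff_eulerInvSeries_pow_le (hq : 2 ≤ q) (k n : ℕ) :
    |PowerSeries.coeff n (eulerInvSeries q⁻¹ ^ (k + 1))| ≤ gaussTerm q k n := by
  have h := norm_coeff_mul_prod_le_gaussTerm hq (Finset.range k)
    (f := fun _ => eulerInvSeries (q : ℂ)⁻¹) (norm_coeff_eulerInvSeries_le_gaussTerm hq)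
    (fun _ => norm_coeff_eulerInvSeries_le hq) n
  rwa [Finset.prod_const, Finset.card_range, ← pow_succ', ← Complex.ofReal_inv,
    ← map_ofReal_eulerInvSeries, ← map_pow, PowerSeries.coeff_map, Complex.ofRealHom_eq_coe,
    Complex.norm_real] at h

lemma hasSum_coeff_eulerInvSeries_pow (hq : 2 ≤ q) (hc : Tendsto (qPoch q⁻¹) atTop (nhds c))
    (k : ℕ) : HasSum (fun n => PowerSeries.coeff n (eulerInvSeries q⁻¹ ^ k)) (c ^ k) := by
  have hq0 : 0 < q := by linarith
  have h0 : 0 < q⁻¹ := inv_pos.mpr hq0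
  have h1 : q⁻¹ ≤ 1 / 2 := by rw [one_div]; exact inv_anti₀ (by norm_num) hq
  have h1' : q⁻¹ < 1 := by linarith
  have hc0 : 0 < c := by
    have := one_sub_sub_sq_le_of_tendsto_qPoch h0 h1' hc
    nlinarith
  have hs : Summable fun n => ‖PowerSeries.coeff n (eulerInvSeries q⁻¹)‖ :=
    Summable.of_nonneg_of_le (fun _ => norm_nonneg _)
      (fun n => by simpa using abs_coeff_eulerInvSeries_pow_le hq 0 n) (summable_gaussTerm hq 0)
  have hE := hasSum_coeff_eulerSeries h0 h1' hc0.ne' hc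
  have h := tsum_coeff_mul (hE.summable.norm) hs
  rw [eulerSeries_mul_eulerInvSeries (pow_succ_ne_one_of_lt_one h0 h1'), tsum_coeff_one,
    hE.tsum_eq] at h
  have h' : ∑' n, PowerSeries.coeff n (eulerInvSeries q⁻¹) = c := by
    rw [eq_comm, inv_mul_eq_one₀ hc0.ne'] at h
    exact h.symm
  obtain ⟨hsum, htsum⟩ := tsum_coeff_pow hs k
  rw [← h', ← htsum]
  exact hsum.of_norm.hasSum

lemma abs_sum_coeff_eulerInvSeries_sub_le (hq : 2 ≤ q)
    (hc : Tendsto (qPoch q⁻¹) atTop (nhds c)) {k n : ℕ} (hn : 3 * (k + 1) ≤ n) :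
    |∑ i ∈ Finset.range n, PowerSeries.coeff i (eulerInvSeries q⁻¹ ^ (k + 1)) - c ^ (k + 1)| ≤
      2 * gaussTerm q k n := by
  have h := hasSum_coeff_eulerInvSeries_pow hq hc (k + 1)
  rw [← h.tsum_eq, ← h.summable.sum_add_tsum_nat_add n, sub_add_cancel_left, abs_neg]
  refine le_trans ?_ (tsum_gaussTerm_add_le hq hn)
  rw [← Real.norm_eq_abs]
  refine tsum_of_norm_bounded (Summable.hasSum ?_) fun i => ?_
  · simpa only [add_comm n] using (summable_nat_add_iff n).mpr (summable_gaussTerm hq k)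
  · rw [add_comm i]
    exact abs_coeff_eulerInvSeries_pow_le hq k _

end EulerSums

section ErrorTerm

lemma choose_add_succ_le (n k : ℕ) :
    (n + (k + 1)).choose (k + 1) ≤ (n + 1) * (n + k).choose k := by
  refine Nat.le_of_mul_le_mul_right ?_ k.succ_pos
  rw [← add_assoc, ← Nat.add_one_mul_choose_eq, mul_right_comm]
  exact Nat.mul_le_mul_right _ (by rw [Nat.succ_eq_add_one]; nlinarith [Nat.zero_le (n * k)])

variable {q : ℕ}

lemma gammaErr_ge (hq : 2 ≤ q) (n : ℕ) :
    ((n : ℝ) + 1) ^ 2 * ((n + q - 2).choose (q - 2) : ℝ) * ((q : ℝ) / ((q : ℝ) - 1)) ^ n *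
      (q : ℝ) ^ (-((n : ℝ) ^ 2) / (2 * ((q : ℝ) + 1)) + ((q : ℝ) - 1) * (n : ℝ) /
        (2 * ((q : ℝ) + 1)) + ((q : ℝ) - 1) / (4 * ((q : ℝ) + 1))) ≤ gammaErr q n := by
  rw [gammaErr, le_add_iff_nonneg_left]
  positivity

lemma two_mul_gaussTerm_le_gammaErr (hq : 2 ≤ q) {n : ℕ} (hn : 1 ≤ n) :
    2 * gaussTerm q (q - 2) n ≤ gammaErr q n := by
  refine le_trans ?_ (gammaErr_ge hq n)
  obtain ⟨k, rfl⟩ := Nat.exists_eq_add_of_le' hq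
  have hn' : (1 : ℝ) ≤ n := by exact_mod_cast hn
  have hb : (0 : ℝ) ≤ ((k + 2 : ℕ) : ℝ) / (((k + 2 : ℕ) : ℝ) - 1) := by
    rw [Nat.cast_add_one, add_sub_cancel_right]
    positivity
  rw [gaussTerm, ← mul_assoc, ← mul_assoc, show n + (k + 2) - 2 = n + k by omega,
    Nat.add_sub_cancel]
  gcongr
  · nlinarith
  · push_cast
    linarith
  · push_cast
    rw [← sub_nonneg]
    convert_to (0 : ℝ) ≤ (8 * n ^ 2 + 4 * n * ((k + 1) ^ 2 + k * (k + 3)) + (k ^ 2 + k + 2)) /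
      (8 * (k + 1) * (k + 3)) using 1
    · have : (k : ℝ) + 2 + 1 ≠ 0 := by positivity
      field_simp
      ring
    · positivity

lemma gaussTerm_le_gammaErr (hq : 2 ≤ q) (n : ℕ) :
    gaussTerm q q n ≤ gammaErr q (n + 1) := by
  refine le_trans ?_ (gammaErr_ge hq (n + 1))
  obtain ⟨k, rfl⟩ := Nat.exists_eq_add_of_le' hq
  have hb : (1 : ℝ) ≤ ((k + 2 : ℕ) : ℝ) / (((k + 2 : ℕ) : ℝ) - 1) := by
    rw [Nat.cast_add_one, add_sub_cancel_right, one_le_div (by positivity)]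
    linarith
  have hc : ((n + (k + 2)).choose (k + 2) : ℝ) ≤
      (((n + 1 : ℕ) : ℝ) + 1) ^ 2 * ((n + 1 + (k + 2) - 2).choose (k + 2 - 2) : ℝ) := by
    rw [show n + 1 + (k + 2) - 2 = n + 1 + k by omega, Nat.add_sub_cancel]
    norm_cast
    calc (n + (k + 2)).choose (k + 2) ≤ (n + 1) * ((n + 1) * (n + k).choose k) :=
          (choose_add_succ_le n (k + 1)).trans
            (Nat.mul_le_mul_left _ (choose_add_succ_le n k))
      _ = (n + 1) ^ 2 * (n + k).choose k := by ring
      _ ≤ (n + 1 + 1) ^ 2 * (n + 1 + k).choose k :=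
          Nat.mul_le_mul (Nat.pow_le_pow_left (by omega) 2) (Nat.choose_le_choose k (by omega))
  rw [gaussTerm]
  refine mul_le_mul (mul_le_mul hc (pow_le_pow_right₀ hb n.le_succ) (by positivity) (by positivity))
    (Real.rpow_le_rpow_of_exponent_le ?_ ?_) (by positivity) (by positivity)
  · push_cast
    linarith
  · push_cast
    rw [← sub_nonneg]
    convert_to (0 : ℝ) ≤ ((8 * k + 4) * n + 5 * k) / (8 * (k + 3)) using 1
    · have : (k : ℝ) + 2 + 1 ≠ 0 := by positivity
      field_simp
      ring
    · positivity

end ErrorTerm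

section Counting

variable {F : Type*} [Field F]

lemma exists_eq_mul_X_sub_C_iff {p : F[X]} (hp : p.Monic) :
    (∃ (lam : F) (f₀ : F[X]), f₀.Monic ∧ (∀ t : F, f₀.eval t ≠ 0) ∧ p = f₀ * (X - C lam)) ↔
      ∃ lam : F, p.rootMultiplicity lam = 1 ∧ ∀ s ≠ lam, p.eval s ≠ 0 := by
  constructor
  · rintro ⟨lam, f₀, hf, h, rfl⟩
    refine ⟨lam, ?_, fun s hs => ?_⟩
    · have := rootMultiplicity_mul_X_sub_C_pow (a := lam) (n := 1) hf.ne_zero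
      rwa [pow_one, rootMultiplicity_eq_zero (h lam), zero_add] at this
    · rw [eval_mul, eval_sub, eval_X, eval_C]
      exact mul_ne_zero (h s) (sub_ne_zero.mpr hs)
  · rintro ⟨lam, h1, h2⟩
    obtain ⟨f, hf, hdvd⟩ := exists_eq_pow_rootMultiplicity_mul_and_not_dvd p hp.ne_zero lam
    rw [h1, pow_one] at hf
    refine ⟨lam, f, (monic_X_sub_C lam).of_mul_monic_left (hf ▸ hp), fun t ht => ?_,
      by rw [mul_comm, ← hf]⟩
    rcases eq_or_ne t lam with rfl | hne
    · exact hdvd (dvd_iff_isRoot.mpr ht)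
    · exact h2 t hne (by rw [hf, eval_mul, ht, mul_zero])

variable [Fintype F]

open Classical in
lemma sum_rootMultiplicity_eq_one (ψ : AddChar F ℂ) (lam : F) (n : ℕ) :
    (∑ A : Matrix (Fin (n + 1)) (Fin (n + 1)) F with
        A.charpoly.rootMultiplicity lam = 1 ∧ ∀ s ≠ lam, A.charpoly.eval s ≠ 0,
      ψ (A * A).trace) / cardGL F (n + 1) =
      ψ (lam * lam) * (cardNilpotent F 1 / cardGL F 1) *
        (totalWeight Finset.univ ψ n / cardGL F n) := by
  have h := sum_eigenfreeWeight_rootMultiplicity (Finset.univ.erase lam) ψ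
    (Finset.notMem_erase lam _) (add_comm 1 n)
  rw [Finset.insert_erase (Finset.mem_univ lam), pow_one] at h
  rw [← h]
  congr 1
  rw [Finset.sum_filter, Finset.sum_filter,
    ← Equiv.sum_comp (Equiv.addRight (Matrix.scalar (Fin (n + 1)) lam))]
  refine Finset.sum_congr rfl fun T _ => ?_
  have hT : T.charpoly.rootMultiplicity 0 =
      (T + Matrix.scalar (Fin (n + 1)) lam).charpoly.rootMultiplicity lam := by
    rw [rootMultiplicity_eq_rootMultiplicity (t := lam), ← Matrix.charpoly_sub_scalar,
      add_sub_cancel_right]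
  have hS : (∀ s ≠ lam, (T + Matrix.scalar (Fin (n + 1)) lam).charpoly.eval s ≠ 0) ↔
      ∀ s ∈ Finset.univ.erase lam, IsUnit (T + Matrix.scalar (Fin (n + 1)) lam -
        Matrix.scalar (Fin (n + 1)) s) := by
    simp only [← eval_charpoly_ne_zero_iff_isUnit, Finset.mem_erase, Finset.mem_univ, and_true]
  simp only [Equiv.coe_addRight, hT, ite_and, eigenfreeWeight, hS]
  split_ifs <;> rfl

lemma cardNilpotent_one_div_cardGL_one :
    (cardNilpotent F 1 : ℂ) / cardGL F 1 = ((Fintype.card F : ℂ) - 1)⁻¹ := by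
  have h := congrArg (PowerSeries.coeff 1) (nilpotentSeries_eq (F := F))
  have hq0 : (Fintype.card F : ℂ) ≠ 0 := Nat.cast_ne_zero.mpr Fintype.card_ne_zero
  rw [nilpotentSeries, PowerSeries.coeff_mk] at h
  rw [h, eulerSeries, PowerSeries.coeff_mk, qPoch_succ, qPoch_zero, one_mul, zero_add,
    pow_one, show 1 - (Fintype.card F : ℂ)⁻¹ = (Fintype.card F : ℂ)⁻¹ * (Fintype.card F - 1) by
      field_simp, ← div_div, div_self (inv_ne_zero hq0), one_div]

/-- `A` has a unique eigenvalue in the base field, and it is simple. -/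
def HasUniqueSimpleEigenvalue {n : ℕ} (A : Matrix (Fin n) (Fin n) F) : Prop :=
  ∃ (lam : F) (f₀ : F[X]), f₀.Monic ∧ (∀ t : F, f₀.eval t ≠ 0) ∧ A.charpoly = f₀ * (X - C lam)

open Classical in
lemma sum_hasUniqueSimpleEigenvalue (ψ : AddChar F ℂ) (n : ℕ) :
    (∑ A : Matrix (Fin (n + 1)) (Fin (n + 1)) F with HasUniqueSimpleEigenvalue A,
      ψ (A * A).trace) / cardGL F (n + 1) =
      (∑ lam : F, ψ (lam * lam)) * ((Fintype.card F : ℂ) - 1)⁻¹ *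
        PowerSeries.coeff n (weightSeries Finset.univ ψ) := by
  rw [weightSeries, PowerSeries.coeff_mk, ← cardNilpotent_one_div_cardGL_one, Finset.sum_mul,
    Finset.sum_mul]
  simp only [← sum_rootMultiplicity_eq_one]
  rw [← Finset.sum_div]
  congr 1
  simp only [Finset.sum_filter]
  rw [Finset.sum_comm]
  refine Finset.sum_congr rfl fun A _ => ?_
  have hA := exists_eq_mul_X_sub_C_iff A.charpoly_monic
  by_cases h : HasUniqueSimpleEigenvalue A
  · obtain ⟨lam, h1, h2⟩ := hA.mp h
    rw [if_pos h, Finset.sum_eq_single lam, if_pos ⟨h1, h2⟩]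
    · intro μ _ hμ
      refine if_neg fun h' => h2 μ hμ ?_
      exact (rootMultiplicity_pos A.charpoly_monic.ne_zero).mp (by omega)
    · simp
  · rw [if_neg h, Finset.sum_eq_zero]
    exact fun lam _ => if_neg fun h' => h (hA.mpr ⟨lam, h'⟩)

open Classical in
lemma card_mul_card_trace_eq_zero {n : ℕ} (P : Matrix (Fin n) (Fin n) F → Prop) :
    (Fintype.card F : ℂ) * Nat.card {A : Matrix (Fin n) (Fin n) F // (A * A).trace = 0 ∧ P A} =
      ∑ ψ : AddChar F ℂ, ∑ A : Matrix (Fin n) (Fin n) F with P A, ψ (A * A).trace := by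
  rw [Finset.sum_comm]
  simp only [AddChar.sum_apply_eq_ite]
  rw [← Finset.sum_filter, Finset.filter_filter, Finset.sum_const, nsmul_eq_mul,
    Nat.card_eq_fintype_card, Fintype.card_subtype, mul_comm]
  simp only [and_comm]

end Counting

section Estimates

variable {F : Type*} [Field F] [Fintype F]

lemma norm_totalWeight_empty_le {ψ : AddChar F ℂ} (hψ : ψ ≠ 1) (n : ℕ) :
    ‖totalWeight ∅ ψ n‖ ≤ (Fintype.card F : ℝ) ^ ((n : ℝ) ^ 2 / 2) := by
  refine le_of_sq_le_sq ?_ (by positivity)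
  refine (norm_totalWeight_empty_sq_le hψ n).trans_eq ?_
  rw [← Real.rpow_natCast, ← Real.rpow_natCast, ← Real.rpow_mul (Nat.cast_nonneg _)]
  push_cast
  ring_nf

lemma two_le_card : (2 : ℝ) ≤ Fintype.card F := by
  exact_mod_cast Fintype.one_lt_card (α := F)

lemma cardGL_eq_real (n : ℕ) :
    (cardGL F n : ℝ) = (Fintype.card F : ℝ) ^ (n * n) * qPoch (Fintype.card F : ℝ)⁻¹ n := by
  have h := cardGL_eq (F := F) n
  rw [← Complex.ofReal_natCast (Fintype.card F), ← Complex.ofReal_inv, ← ofReal_qPoch] at h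
  exact_mod_cast h

lemma norm_coeff_weightSeries_empty_le {ψ : AddChar F ℂ} (hψ : ψ ≠ 1) (n : ℕ) :
    ‖PowerSeries.coeff n (weightSeries ∅ ψ)‖ ≤ gaussTerm (Fintype.card F) 0 n := by
  have hq : (0 : ℝ) < Fintype.card F := by linarith [two_le_card (F := F)]
  rw [weightSeries, PowerSeries.coeff_mk, norm_div, Complex.norm_natCast, cardGL_eq_real,
    ← div_div, div_eq_mul_inv _ (qPoch _ _), gaussTerm_zero, mul_comm]
  gcongr
  · exact pow_nonneg (div_nonneg hq.le (by linarith [two_le_card (F := F)])) n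
  · exact inv_qPoch_le two_le_card n
  · rw [← Real.rpow_natCast _ (n * n), div_le_iff₀ (by positivity), ← Real.rpow_add hq]
    refine (norm_totalWeight_empty_le hψ n).trans_eq (congrArg _ ?_)
    push_cast
    ring

lemma norm_coeff_weightSeries_univ_le {ψ : AddChar F ℂ} (hψ : ψ ≠ 1) (n : ℕ) :
    ‖PowerSeries.coeff n (weightSeries Finset.univ ψ)‖ ≤
      gaussTerm (Fintype.card F) (Fintype.card F) n := by
  rw [weightSeries_eq_prod]
  refine norm_coeff_mul_prod_le_gaussTerm two_le_card Finset.univ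
    (norm_coeff_weightSeries_empty_le hψ) (fun t m => ?_) n
  rw [PowerSeries.coeff_rescale, norm_mul, norm_pow, AddChar.norm_apply, one_pow, one_mul]
  exact norm_coeff_eulerInvSeries_le two_le_card m

lemma coeff_weightSeries_univ_one (n : ℕ) :
    PowerSeries.coeff n (weightSeries (Finset.univ : Finset F) 1) =
      ((∑ i ∈ Finset.range (n + 1), PowerSeries.coeff i
        (eulerInvSeries (Fintype.card F : ℝ)⁻¹ ^ (Fintype.card F - 1)) : ℝ) : ℂ) := by
  rw [weightSeries_univ_one, mul_comm, PowerSeries.coeff_mul,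
    Finset.Nat.sum_antidiagonal_eq_sum_range_succ_mk, ← Complex.ofReal_natCast,
    ← Complex.ofReal_inv, ← map_ofReal_eulerInvSeries, ← map_pow]
  simp [-map_pow]

variable (F) in
lemma abs_card_trace_sq_eq_zero_sub_le (n : ℕ) :
    |(Fintype.card F : ℝ) * Nat.card {A : Matrix (Fin n) (Fin n) F // (A * A).trace = 0} /
        (Fintype.card F : ℝ) ^ (n * n) - 1| ≤
      ((Fintype.card F : ℝ) - 1) * (Fintype.card F : ℝ) ^ (-(n : ℝ) ^ 2 / 2) := by
  classical
  have hq : (0 : ℝ) < Fintype.card F := by linarith [two_le_card (F := F)]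
  have h := card_mul_card_trace_eq_zero (F := F) (n := n) (fun _ => True)
  simp only [and_true, Finset.filter_true, ← totalWeight_empty] at h
  rw [← Finset.add_sum_erase _ _ (Finset.mem_univ 1)] at h
  have h1 : totalWeight (F := F) ∅ 1 n = (Fintype.card F : ℂ) ^ (n * n) := by
    simp [totalWeight_empty, card_square_matrix]
  rw [h1] at h
  have h2 : ‖∑ ψ ∈ Finset.univ.erase (1 : AddChar F ℂ), totalWeight ∅ ψ n‖ ≤
      ((Fintype.card F : ℝ) - 1) * (Fintype.card F : ℝ) ^ ((n : ℝ) ^ 2 / 2) := by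
    refine (norm_sum_le_of_le _ fun ψ hψ =>
      norm_totalWeight_empty_le (Finset.ne_of_mem_erase hψ) n).trans_eq ?_
    rw [Finset.sum_const, Finset.card_erase_of_mem (Finset.mem_univ _), Finset.card_univ,
      nsmul_eq_mul, AddChar.card_eq, Nat.cast_sub Fintype.card_pos, Nat.cast_one]
  rw [← sub_eq_iff_eq_add'] at h
  rw [← h] at h2
  have h3 : (Fintype.card F : ℝ) ^ (n * n) ≠ 0 := by positivity
  rw [div_sub_one h3, abs_div, abs_of_pos (show 0 < (Fintype.card F : ℝ) ^ (n * n) by positivity),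
    div_le_iff₀ (by positivity), mul_assoc]
  refine (Eq.le ?_).trans (h2.trans_eq (congrArg _ ?_))
  · rw [← Real.norm_eq_abs, ← Complex.norm_real]
    simp
  · rw [← Real.rpow_natCast _ (n * n), ← Real.rpow_add hq]
    push_cast
    ring_nf

variable (F) in
lemma abs_card_hasUniqueSimpleEigenvalue_sub_le (n : ℕ) :
    |((Fintype.card F : ℝ) - 1) * Nat.card {A : Matrix (Fin (n + 1)) (Fin (n + 1)) F //
        (A * A).trace = 0 ∧ HasUniqueSimpleEigenvalue A} / cardGL F (n + 1) -
      ∑ i ∈ Finset.range (n + 1), PowerSeries.coeff i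
        (eulerInvSeries (Fintype.card F : ℝ)⁻¹ ^ (Fintype.card F - 1))| ≤
      ((Fintype.card F : ℝ) - 1) * gaussTerm (Fintype.card F) (Fintype.card F) n := by
  classical
  have hq : (1 : ℝ) < Fintype.card F := by linarith [two_le_card (F := F)]
  have hqC : (Fintype.card F : ℂ) - 1 ≠ 0 := by
    exact_mod_cast (sub_pos.mpr hq).ne'
  have h := congrArg (· / (cardGL F (n + 1) : ℂ))
    (card_mul_card_trace_eq_zero (F := F) (n := n + 1) HasUniqueSimpleEigenvalue)
  simp only [Finset.sum_div (s := Finset.univ) (ι := AddChar F ℂ),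
    sum_hasUniqueSimpleEigenvalue] at h
  rw [← Finset.add_sum_erase _ _ (Finset.mem_univ 1), coeff_weightSeries_univ_one] at h
  have h1 : ∑ lam : F, (1 : AddChar F ℂ) (lam * lam) = Fintype.card F := by simp
  rw [h1] at h
  set e := ∑ i ∈ Finset.range (n + 1), PowerSeries.coeff i
    (eulerInvSeries (Fintype.card F : ℝ)⁻¹ ^ (Fintype.card F - 1))
  set N := Nat.card {A : Matrix (Fin (n + 1)) (Fin (n + 1)) F //
    (A * A).trace = 0 ∧ HasUniqueSimpleEigenvalue A}
  set W := ∑ ψ ∈ Finset.univ.erase (1 : AddChar F ℂ), (∑ lam : F, ψ (lam * lam)) *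
    ((Fintype.card F : ℂ) - 1)⁻¹ * PowerSeries.coeff n (weightSeries Finset.univ ψ) with hW
  have hWle : ‖W‖ ≤ Fintype.card F * gaussTerm (Fintype.card F) (Fintype.card F) n := by
    have hle : ∀ ψ ∈ Finset.univ.erase (1 : AddChar F ℂ), ‖(∑ lam : F, ψ (lam * lam)) *
        ((Fintype.card F : ℂ) - 1)⁻¹ * PowerSeries.coeff n (weightSeries Finset.univ ψ)‖ ≤
        Fintype.card F * ((Fintype.card F : ℝ) - 1)⁻¹ *
          gaussTerm (Fintype.card F) (Fintype.card F) n := fun ψ hψ => by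
      rw [norm_mul, norm_mul]
      gcongr
      · refine (norm_sum_le_of_le _ fun lam _ => (AddChar.norm_apply ψ _).le).trans_eq ?_
        simp
      · rw [norm_inv, ← Complex.ofReal_natCast, ← Complex.ofReal_one, ← Complex.ofReal_sub,
          Complex.norm_real, Real.norm_eq_abs, abs_of_pos (sub_pos.mpr hq)]
      · exact norm_coeff_weightSeries_univ_le (Finset.ne_of_mem_erase hψ) n
    refine (norm_sum_le_of_le _ hle).trans_eq ?_
    rw [Finset.sum_const, Finset.card_erase_of_mem (Finset.mem_univ _), Finset.card_univ,
      nsmul_eq_mul, AddChar.card_eq, Nat.cast_sub Fintype.card_pos, Nat.cast_one]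
    field_simp [(sub_pos.mpr hq).ne']
  have hdiff : ((((Fintype.card F : ℝ) - 1) * N / cardGL F (n + 1) - e : ℝ) : ℂ) =
      ((Fintype.card F : ℂ) - 1) / Fintype.card F * W := by
    push_cast
    have hq0 : (Fintype.card F : ℂ) ≠ 0 := by exact_mod_cast Fintype.card_ne_zero
    rw [← sub_eq_iff_eq_add'] at h
    rw [← h]
    field_simp
  rw [← Real.norm_eq_abs, ← Complex.norm_real, hdiff, norm_mul, norm_div, Complex.norm_natCast,
    ← Complex.ofReal_natCast, ← Complex.ofReal_one, ← Complex.ofReal_sub,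
    Complex.norm_real, Real.norm_eq_abs, abs_of_pos (sub_pos.mpr hq),
    div_mul_eq_mul_div, div_le_iff₀ (by linarith), mul_assoc, mul_comm (gaussTerm _ _ _)]
  exact mul_le_mul_of_nonneg_left hWle (sub_pos.mpr hq).le

end Estimates

lemma exp_lt_mul_pow_div {q : ℕ} (hq : 2 ≤ q) {c : ℝ} (hc : 1 - (q : ℝ)⁻¹ - (q : ℝ)⁻¹ ^ 2 ≤ c) :
    Real.exp (-23 / 9) < (q : ℝ) * c ^ q / ((q : ℝ) - 1) := by
  rcases hq.eq_or_lt with rfl | hq3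
  · have h8 : Real.exp (-23 / 9) < 1 / 8 := by
      rw [← Real.lt_log_iff_exp_lt (by norm_num), show (1 / 8 : ℝ) = (2 ^ 3)⁻¹ by norm_num,
        Real.log_inv, Real.log_pow]
      have := Real.log_two_lt_d9
      norm_num
      linarith
    norm_num at hc ⊢
    nlinarith
  · have hq' : (3 : ℝ) ≤ q := by exact_mod_cast hq3
    have hd : 0 < (q : ℝ) ^ 2 - q - 1 := by nlinarith
    have hy : 1 - (q : ℝ)⁻¹ - (q : ℝ)⁻¹ ^ 2 = ((q : ℝ) ^ 2 - q - 1) / (q : ℝ) ^ 2 := by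
      field_simp
    have hy0 : 0 < 1 - (q : ℝ)⁻¹ - (q : ℝ)⁻¹ ^ 2 := by
      rw [hy]
      positivity
    have hc0 := hy0.trans_le hc
    have hlog : (-12 / 5 : ℝ) ≤ q * Real.log (1 - (q : ℝ)⁻¹ - (q : ℝ)⁻¹ ^ 2) := by
      refine le_trans ?_ (mul_le_mul_of_nonneg_left (Real.one_sub_inv_le_log_of_pos hy0)
        q.cast_nonneg)
      have h : (q : ℝ) * (1 - (1 - (q : ℝ)⁻¹ - (q : ℝ)⁻¹ ^ 2)⁻¹) =
          -((q : ℝ) ^ 2 + q) / ((q : ℝ) ^ 2 - q - 1) := by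
        rw [hy, inv_div, one_sub_div hd.ne', mul_div_assoc']
        ring_nf
      rw [h, le_div_iff₀ hd]
      nlinarith
    have hpow : Real.exp (-23 / 9) < c ^ q := by
      refine lt_of_lt_of_le ?_ (pow_le_pow_left₀ hy0.le hc q)
      rw [← Real.lt_log_iff_exp_lt (pow_pos hy0 q), Real.log_pow]
      linarith
    refine hpow.trans_le ?_
    rw [le_div_iff₀ (by linarith), mul_comm]
    exact mul_le_mul_of_nonneg_right (by linarith) (pow_pos hc0 q).le

lemma abs_mul_sub_mul_div_le {b c C P E D d : ℝ} (hb : 0 ≤ b) (hc0 : 0 ≤ c) (hC0 : 0 ≤ C)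
    (hC1 : C ≤ 1) (hcP : c ≤ P) (hP1 : P ≤ 1) (hD : |D - 1| ≤ d) (hd : d < 1) :
    |b * (c * C) - b * (P * E / D)| ≤ b / (1 - d) * ((P - c) + |E - C| + d) := by
  have hD1 : 1 - d ≤ D := by linarith [(abs_le.mp hD).1]
  have hd1 : 0 < 1 - d := sub_pos.mpr hd
  have hD0 : 0 < D := hd1.trans_le hD1
  have hP0 : 0 ≤ P := hc0.trans hcP
  have h : b * (c * C) - b * (P * E / D) =
      b / D * ((c - P) * C + P * (C - E) + c * C * (D - 1)) := by
    field_simp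
    ring
  rw [h, abs_mul, abs_of_nonneg (div_nonneg hb hD0.le)]
  have h1 : |(c - P) * C| ≤ P - c := by
    rw [abs_mul, abs_of_nonneg hC0, abs_sub_comm, abs_of_nonneg (sub_nonneg.mpr hcP)]
    exact mul_le_of_le_one_right (sub_nonneg.mpr hcP) hC1
  have h2 : |P * (C - E)| ≤ |E - C| := by
    rw [abs_mul, abs_of_nonneg hP0, abs_sub_comm]
    exact mul_le_of_le_one_left (abs_nonneg _) hP1
  have h3 : |c * C * (D - 1)| ≤ d := by
    rw [abs_mul, abs_of_nonneg (mul_nonneg hc0 hC0)]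
    exact (mul_le_of_le_one_left (abs_nonneg _)
      (mul_le_one₀ (hcP.trans hP1) hC0 hC1)).trans hD
  gcongr
  exact (abs_add_three _ _ _).trans (add_le_add (add_le_add h1 h2) h3)

section Proportion

variable (F : Type*) [Field F] [Fintype F]

lemma gammaSD_eq (n : ℕ) :
    gammaSD F n = (Fintype.card F : ℝ) / ((Fintype.card F : ℝ) - 1) *
      (qPoch (Fintype.card F : ℝ)⁻¹ n *
        (((Fintype.card F : ℝ) - 1) * Nat.card {A : Matrix (Fin n) (Fin n) F //
          (A * A).trace = 0 ∧ HasUniqueSimpleEigenvalue A} / cardGL F n) /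
        ((Fintype.card F : ℝ) * Nat.card {A : Matrix (Fin n) (Fin n) F // (A * A).trace = 0} /
          (Fintype.card F : ℝ) ^ (n * n))) := by
  have hq : (0 : ℝ) < Fintype.card F := by linarith [two_le_card (F := F)]
  have hq1 : (0 : ℝ) < (Fintype.card F : ℝ) - 1 := by linarith [two_le_card (F := F)]
  have : Nonempty {A : Matrix (Fin n) (Fin n) F // (A * A).trace = 0} := ⟨0, by simp⟩
  have hden : (Nat.card {A : Matrix (Fin n) (Fin n) F // (A * A).trace = 0} : ℝ) ≠ 0 :=
    Nat.cast_ne_zero.mpr Nat.card_pos.ne'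
  have hP := (qPoch_pos (inv_pos.mpr hq) (inv_lt_one_of_one_lt₀ (sub_pos.mp hq1)) n).ne'
  rw [cardGL_eq_real]
  generalize qPoch (Fintype.card F : ℝ)⁻¹ n = P at hP ⊢
  change (Nat.card {A : Matrix (Fin n) (Fin n) F //
    (A * A).trace = 0 ∧ HasUniqueSimpleEigenvalue A} : ℝ) / _ = _
  field_simp

lemma tendsto_gaussTerm {q : ℝ} (hq : 2 ≤ q) (k : ℕ) :
    Tendsto (gaussTerm q k) atTop (nhds 0) :=
  (summable_gaussTerm hq k).tendsto_atTop_zero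

lemma tendsto_gammaSD {c : ℝ}
    (hc : Tendsto (qPoch (Fintype.card F : ℝ)⁻¹) atTop (nhds c)) :
    Tendsto (gammaSD F) atTop
      (nhds ((Fintype.card F : ℝ) / ((Fintype.card F : ℝ) - 1) *
        (c * c ^ (Fintype.card F - 1)))) := by
  have hq : (2 : ℝ) ≤ Fintype.card F := two_le_card
  have hE : Tendsto (fun n => ((Fintype.card F : ℝ) - 1) *
      Nat.card {A : Matrix (Fin (n + 1)) (Fin (n + 1)) F //
        (A * A).trace = 0 ∧ HasUniqueSimpleEigenvalue A} / cardGL F (n + 1))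
      atTop (nhds (c ^ (Fintype.card F - 1))) := by
    have h1 := ((hasSum_coeff_eulerInvSeries_pow hq hc (Fintype.card F - 1)).tendsto_sum_nat).comp
      (tendsto_add_atTop_nat 1)
    have h2 := squeeze_zero_norm
      (fun n => (Real.norm_eq_abs _).trans_le (abs_card_hasUniqueSimpleEigenvalue_sub_le F n))
      (by simpa using (tendsto_gaussTerm hq (Fintype.card F)).const_mul ((Fintype.card F : ℝ) - 1))
    simpa using h1.add h2
  have hD : Tendsto (fun n => (Fintype.card F : ℝ) *
      Nat.card {A : Matrix (Fin n) (Fin n) F // (A * A).trace = 0} /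
        (Fintype.card F : ℝ) ^ (n * n)) atTop (nhds 1) := by
    have h0 : Tendsto (fun n : ℕ => ((Fintype.card F : ℝ) - 1) *
        (Fintype.card F : ℝ) ^ (-(n : ℝ) ^ 2 / 2)) atTop (nhds 0) := by
      have := (tendsto_gaussTerm hq 0).const_mul ((Fintype.card F : ℝ) - 1)
      rw [mul_zero] at this
      refine squeeze_zero (fun n => mul_nonneg (by linarith) (by positivity)) (fun n => ?_) this
      rw [gaussTerm_zero, neg_div]
      refine mul_le_mul_of_nonneg_left (le_mul_of_one_le_left (by positivity)
        (one_le_pow₀ ?_)) (by linarith)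
      rw [one_le_div (by linarith)]
      linarith
    have h1 := squeeze_zero_norm
      (fun n => (Real.norm_eq_abs _).trans_le (abs_card_trace_sq_eq_zero_sub_le F n)) h0
    simpa using h1.add_const 1
  rw [← tendsto_add_atTop_iff_nat 1]
  have hlim := (((hc.comp (tendsto_add_atTop_nat 1)).mul hE).div
    (hD.comp (tendsto_add_atTop_nat 1)) one_ne_zero).const_mul
      ((Fintype.card F : ℝ) / ((Fintype.card F : ℝ) - 1))
  rw [div_one] at hlim
  exact hlim.congr fun n => (gammaSD_eq F (n + 1)).symm

end Proportion

section ErrorBound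

variable {F : Type*} [Field F] [Fintype F] {c : ℝ}

lemma abs_card_hasUniqueSimpleEigenvalue_sub_pow_le
    (hc : Tendsto (qPoch (Fintype.card F : ℝ)⁻¹) atTop (nhds c)) {n : ℕ}
    (hn : 3 * (Fintype.card F - 1) ≤ n + 1) :
    |((Fintype.card F : ℝ) - 1) * Nat.card {A : Matrix (Fin (n + 1)) (Fin (n + 1)) F //
        (A * A).trace = 0 ∧ HasUniqueSimpleEigenvalue A} / cardGL F (n + 1) -
      c ^ (Fintype.card F - 1)| ≤ Fintype.card F * gammaErr (Fintype.card F) (n + 1) := by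
  have hq : (2 : ℝ) ≤ Fintype.card F := two_le_card
  have hq' : 2 ≤ Fintype.card F := Fintype.one_lt_card
  have hk : Fintype.card F - 2 + 1 = Fintype.card F - 1 := by omega
  have h1 := abs_sum_coeff_eulerInvSeries_sub_le hq hc (k := Fintype.card F - 2) (hk ▸ hn)
  rw [hk] at h1
  have h2 := abs_card_hasUniqueSimpleEigenvalue_sub_le F n
  have h3 := two_mul_gaussTerm_le_gammaErr hq' n.succ_pos
  have h4 := mul_le_mul_of_nonneg_left (gaussTerm_le_gammaErr hq' n)
    (show (0 : ℝ) ≤ Fintype.card F - 1 by linarith)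
  refine (abs_sub_le _ _ _).trans ((add_le_add h2 (h1.trans h3)).trans ?_)
  linarith

end ErrorBound

/-- `γ(n, q)` converges as `n → ∞` to `γ(∞, q) = q·c(q)^q/(q−1) > e^{−23/9}`, and for every
`n` with `n − 1 ≥ 5(q−1)²`,
`|γ(∞, q) − γ(n, q)| ≤ (q²/(1 − (q−1)·q^{−n²/2}))·((q−1)·q^{−n²/2 − 1} +
(q/(q−1))·(q^{−(n+1)} + Γ(n, q)))`. -/
theorem stmt_18 (F : Type*) [Field F] [Fintype F] (q : ℕ) (hq : Fintype.card F = q) (c : ℝ)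
    (hc : Tendsto (fun n : ℕ => ∏ i ∈ Finset.Icc 1 n, (1 - ((q : ℝ))⁻¹ ^ i)) atTop (nhds c)) :
    Tendsto (fun n : ℕ => gammaSD F n) atTop (nhds ((q : ℝ) * c ^ q / ((q : ℝ) - 1))) ∧
    (q : ℝ) * c ^ q / ((q : ℝ) - 1) > Real.exp (-23 / 9) ∧
    ∀ n : ℕ, 5 * (q - 1) ^ 2 + 1 ≤ n →
      |(q : ℝ) * c ^ q / ((q : ℝ) - 1) - gammaSD F n|
        ≤ ((q : ℝ) ^ 2 / (1 - ((q : ℝ) - 1) * (q : ℝ) ^ (-((n : ℝ) ^ 2) / 2))) *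
            (((q : ℝ) - 1) * (q : ℝ) ^ (-((n : ℝ) ^ 2) / 2 - 1)
              + ((q : ℝ) / ((q : ℝ) - 1)) * (((q : ℝ))⁻¹ ^ (n + 1) + gammaErr q n)) := by
  subst hq
  change Tendsto (qPoch (Fintype.card F : ℝ)⁻¹) atTop (nhds c) at hc
  have hq : (2 : ℝ) ≤ Fintype.card F := two_le_card
  have hq' : 2 ≤ Fintype.card F := Fintype.one_lt_card
  have hq0 : (0 : ℝ) < Fintype.card F := by linarith
  have hq1 : (0 : ℝ) < (Fintype.card F : ℝ) - 1 := by linarith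
  have hx0 : 0 < (Fintype.card F : ℝ)⁻¹ := inv_pos.mpr hq0
  have hx1 : (Fintype.card F : ℝ)⁻¹ < 1 := inv_lt_one_of_one_lt₀ (sub_pos.mp hq1)
  have hlim : (Fintype.card F : ℝ) * c ^ Fintype.card F / ((Fintype.card F : ℝ) - 1) =
      (Fintype.card F : ℝ) / ((Fintype.card F : ℝ) - 1) * (c * c ^ (Fintype.card F - 1)) := by
    rw [mul_pow_sub_one Fintype.card_ne_zero, mul_div_right_comm]
  refine ⟨hlim ▸ tendsto_gammaSD F hc,
    exp_lt_mul_pow_div hq' (one_sub_sub_sq_le_of_tendsto_qPoch hx0 hx1 hc), fun n hn => ?_⟩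
  have hn6 : 6 ≤ n := by nlinarith [Nat.one_le_iff_ne_zero.mpr (Nat.sub_ne_zero_of_lt hq')]
  have hn3 : 3 * (Fintype.card F - 1) ≤ n := by
    nlinarith [Nat.one_le_iff_ne_zero.mpr (Nat.sub_ne_zero_of_lt hq')]
  obtain ⟨m, rfl⟩ := Nat.exists_eq_add_of_le' (by omega : 1 ≤ n)
  have hc0 : 0 ≤ c := ge_of_tendsto' hc fun k => (qPoch_pos hx0 hx1 k).le
  have hcP := (qPoch_antitone hx0 hx1).le_of_tendsto hc (m + 1)
  have hP1 := qPoch_le_one hx0 hx1 (m + 1)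
  have hδ : ((Fintype.card F : ℝ) - 1) * (Fintype.card F : ℝ) ^ (-((m + 1 : ℕ) : ℝ) ^ 2 / 2) <
      1 := by
    have hm : (6 : ℝ) ≤ ((m + 1 : ℕ) : ℝ) := by exact_mod_cast hn6
    have h : (Fintype.card F : ℝ) ^ (-((m + 1 : ℕ) : ℝ) ^ 2 / 2) ≤ (Fintype.card F : ℝ)⁻¹ := by
      rw [← Real.rpow_neg_one]
      exact Real.rpow_le_rpow_of_exponent_le (by linarith) (by nlinarith)
    refine (mul_le_mul_of_nonneg_left h hq1.le).trans_lt ?_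
    rw [← div_eq_mul_inv, div_lt_one hq0]
    linarith
  have hE := abs_card_hasUniqueSimpleEigenvalue_sub_pow_le hc hn3
  have hb : (Fintype.card F : ℝ) / ((Fintype.card F : ℝ) - 1) ≤ 2 := by
    rw [div_le_iff₀ hq1]
    linarith
  have hPc : qPoch (Fintype.card F : ℝ)⁻¹ (m + 1) - c ≤
      (Fintype.card F : ℝ) / ((Fintype.card F : ℝ) - 1) *
        (Fintype.card F : ℝ)⁻¹ ^ (m + 1 + 1) := by
    refine (qPoch_sub_le_of_tendsto hx0 hx1 hc (m + 1)).trans_eq ?_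
    rw [div_eq_mul_inv, mul_comm]
    congr 1
    field_simp
  rw [hlim, gammaSD_eq]
  refine (abs_mul_sub_mul_div_le (div_pos hq0 hq1).le hc0 (pow_nonneg hc0 _)
    (pow_le_one₀ hc0 (hcP.trans hP1)) hcP hP1 (abs_card_trace_sq_eq_zero_sub_le F (m + 1))
    hδ).trans ?_
  rw [div_mul_eq_mul_div _ (1 - _), div_mul_eq_mul_div (_ ^ 2)]
  refine div_le_div_of_nonneg_right ?_ (sub_pos.mpr hδ).le
  rw [Real.rpow_sub_one hq0.ne']
  set Q : ℝ := (Fintype.card F : ℝ)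
  set b := Q / (Q - 1)
  set d := Q ^ (-((m + 1 : ℕ) : ℝ) ^ 2 / 2)
  set g := gammaErr (Fintype.card F) (m + 1)
  set y := Q⁻¹ ^ (m + 1 + 1)
  have hg : 0 ≤ g := le_trans (mul_nonneg zero_le_two (gaussTerm_nonneg hq _ _))
    (two_mul_gaussTerm_le_gammaErr hq' m.succ_pos)
  have hb0 : 0 < b := div_pos hq0 hq1
  have hy : 0 ≤ y := by positivity
  have hd : 0 ≤ (Q - 1) * d := mul_nonneg hq1.le (by positivity)
  calc b * _ ≤ b * (b * y + Q * g + (Q - 1) * d) := by gcongr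
    _ = b * (b * y) + b * (Q * g) + b * ((Q - 1) * d) := by ring
    _ ≤ Q ^ 2 * (b * y) + b * (Q ^ 2 * g) + Q * ((Q - 1) * d) := by
        gcongr
        · nlinarith
        · nlinarith
        · linarith
    _ = _ := by
        field_simp
        ring
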